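/- arXiv:1207.1927 — 5 statements merged into one kernel-verified Lean document; each statement's English description precedes it below -/
import Mathlib

section
/- Let the puzzle graph be the ring (n-cycle) on n vertices and let the people graph be the Erdős–Rényi random graph G(n, p). Then for all sufficiently large n the critical value satisfies p_c(n) ≥ 1/(27 log n), and lim sup_{n→∞} p_c(n) · log n ≤ π²/6. -/
open MeasureTheory Filter Topology

namespace Jigsaw

variable {V : Type*}

/-- Two vertex sets are adjacent in the graph `G` if some element of one is
`G`-adjacent to some element of the other. -/
def SetAdj (G : SimpleGraph V) (U W : Set V) : Prop :=
  ∃ u ∈ U, ∃ w ∈ W, G.Adj u w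

/-- The auxiliary graph on the blocks of a collection `C`, joining pairs of distinct
blocks that are both people-adjacent and puzzle-adjacent. -/
def clusterGraph (Gpe Gpu : SimpleGraph V) (C : Set (Set V)) : SimpleGraph C where
  Adj U W := U ≠ W ∧ SetAdj Gpe U.1 W.1 ∧ SetAdj Gpu U.1 W.1
  symm := by
    refine ⟨?_⟩
    rintro U W ⟨hne, ⟨u, hu, w, hw, ha⟩, ⟨u', hu', w', hw', ha'⟩⟩
    exact ⟨hne.symm, ⟨w, hw, u, hu, ha.symm⟩, ⟨w', hw', u', hu', ha'.symm⟩⟩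
  loopless := ⟨fun U h => h.1 rfl⟩

/-- One step of jigsaw percolation: within each connected component of the cluster
graph, merge all blocks of that component into a single block. -/
def step (Gpe Gpu : SimpleGraph V) (C : Set (Set V)) : Set (Set V) :=
  { S | ∃ cc : (clusterGraph Gpe Gpu C).ConnectedComponent,
      S = ⋃₀ { U : Set V | ∃ h : U ∈ C,
        (clusterGraph Gpe Gpu C).connectedComponentMk ⟨U, h⟩ = cc } }

/-- The partition `C_i` after `i` steps of jigsaw percolation, starting from
singletons. -/
def clusters (Gpe Gpu : SimpleGraph V) : ℕ → Set (Set V)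
  | 0 => { S | ∃ v : V, S = {v} }
  | i + 1 => step Gpe Gpu (clusters Gpe Gpu i)

/-- The people graph `Gpe` solves the puzzle `Gpu`: the process reaches the
partition `{V}`. -/
def Solves (Gpe Gpu : SimpleGraph V) : Prop :=
  ∃ i, clusters Gpe Gpu i = {Set.univ}

/-- `U ⊆ V` is internally solved: jigsaw percolation on `U` with both graphs induced
on `U` ends with the single block `U`. -/
def InternallySolved (Gpe Gpu : SimpleGraph V) (U : Set V) : Prop :=
  Solves (SimpleGraph.induce U Gpe) (SimpleGraph.induce U Gpu)

/-- The graph determined by the Boolean edge indicators `ω`. -/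
def graphOf (ω : Sym2 V → Bool) : SimpleGraph V where
  Adj u v := u ≠ v ∧ ω s(u, v) = true
  symm := by
    refine ⟨?_⟩
    intro u v h
    exact ⟨h.1.symm, by rw [Sym2.eq_swap]; exact h.2⟩
  loopless := ⟨fun u h => h.1 rfl⟩

/-- The Erdős–Rényi measure: each possible edge appears independently with
probability `p` (the parameter is clamped to `[0,1]`, so for `p ∈ [0,1]` each edge
appears with probability exactly `p`). -/
noncomputable def erMeasure (V : Type*) [Fintype V] [DecidableEq V] (p : ℝ) :
    Measure (Sym2 V → Bool) :=
  Measure.pi fun _ : Sym2 V =>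
    (PMF.bernoulli (min (Real.toNNReal p) 1) (min_le_right _ _)).toMeasure

/-- The ring (`n`-cycle) puzzle graph on `Fin n`. -/
def ringGraph (n : ℕ) : SimpleGraph (Fin n) where
  Adj u v := u ≠ v ∧ (((u : ℕ) + 1) % n = (v : ℕ) ∨ ((v : ℕ) + 1) % n = (u : ℕ))
  symm := ⟨fun u v h => ⟨h.1.symm, h.2.symm⟩⟩
  loopless := ⟨fun u h => h.1 rfl⟩

/-- The ring (`n`-cycle) puzzle graph on `ZMod n`. -/
def zmodRing (n : ℕ) : SimpleGraph (ZMod n) where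
  Adj u v := u ≠ v ∧ (u + 1 = v ∨ v + 1 = u)
  symm := ⟨fun u v h => ⟨h.1.symm, h.2.symm⟩⟩
  loopless := ⟨fun u h => h.1 rfl⟩

/-- The interval of residues `[a, b]` in `ZMod n` is `x`-good with respect to the
people graph `Gpe` if some `u ∈ [a, b]` has no people-edge to any vertex of
`[a - x, b + x]`. -/
def xGood {n : ℕ} (Gpe : SimpleGraph (ZMod n)) (x : ℕ) (a b : ℤ) : Prop :=
  ∃ u : ℤ, a ≤ u ∧ u ≤ b ∧
    ∀ w : ℤ, a - x ≤ w → w ≤ b + x → ¬ Gpe.Adj (u : ZMod n) (w : ZMod n)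

/-- The star puzzle graph on `Fin n` with all edges to the last vertex. -/
def starGraph (n : ℕ) : SimpleGraph (Fin n) where
  Adj u v := u ≠ v ∧ ((u : ℕ) = n - 1 ∨ (v : ℕ) = n - 1)
  symm := ⟨fun u v h => ⟨h.1.symm, h.2.symm⟩⟩
  loopless := ⟨fun u h => h.1 rfl⟩

end Jigsaw

namespace Jigsaw

open ProbabilityTheory

instance erMeasure_prob (V : Type*) [Fintype V] [DecidableEq V] (p : ℝ) :
    IsProbabilityMeasure (erMeasure V p) := by
  unfold erMeasure; infer_instance

theorem er_forall_true {V : Type*} [Fintype V] [DecidableEq V] {p : ℝ} (hp0 : 0 < p) (hp1 : p < 1)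
    (E : Finset (Sym2 V)) :
    (erMeasure V p).real {ω | ∀ e ∈ E, ω e = true} = p ^ E.card := by
  have h : {ω : Sym2 V → Bool | ∀ e ∈ E, ω e = true} =
      Set.pi Set.univ (fun e => if e ∈ E then {true} else Set.univ) := by
    ext ω
    simp only [Set.mem_setOf_eq, Set.mem_pi, Set.mem_univ, true_implies]
    refine forall_congr' fun e => ?_
    split_ifs with he <;> simp [he]
  have hpp : (min (Real.toNNReal p) 1 : NNReal) = Real.toNNReal p := by
    apply min_eq_left; simpa using hp1.le
  rw [h, Measure.real, erMeasure, Measure.pi_pi, ENNReal.toReal_prod]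
  have : ∀ e : Sym2 V, ((PMF.bernoulli (min (Real.toNNReal p) 1) (min_le_right _ _)).toMeasure
      (if e ∈ E then {true} else Set.univ)).toReal = if e ∈ E then p else 1 := by
    intro e
    split_ifs with he
    · rw [PMF.toMeasure_apply_singleton _ _ (by measurability), PMF.bernoulli_apply]
      simp [hpp, hp0.le]
    · rw [measure_univ, ENNReal.toReal_one]
  rw [Finset.prod_congr rfl (fun e _ => this e)]
  simp

theorem er_forall_false {V : Type*} [Fintype V] [DecidableEq V] {p : ℝ} (hp0 : 0 < p) (hp1 : p < 1)
    (E : Finset (Sym2 V)) :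
    (erMeasure V p).real {ω | ∀ e ∈ E, ω e = false} = (1 - p) ^ E.card := by
  have h : {ω : Sym2 V → Bool | ∀ e ∈ E, ω e = false} =
      Set.pi Set.univ (fun e => if e ∈ E then {false} else Set.univ) := by
    ext ω
    simp only [Set.mem_setOf_eq, Set.mem_pi, Set.mem_univ, true_implies]
    refine forall_congr' fun e => ?_
    split_ifs with he <;> simp [he]
  have hpp : (min (Real.toNNReal p) 1 : NNReal) = Real.toNNReal p := by
    apply min_eq_left; simpa using hp1.le
  rw [h, Measure.real, erMeasure, Measure.pi_pi, ENNReal.toReal_prod]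
  have : ∀ e : Sym2 V, ((PMF.bernoulli (min (Real.toNNReal p) 1) (min_le_right _ _)).toMeasure
      (if e ∈ E then {false} else Set.univ)).toReal = if e ∈ E then 1 - p else 1 := by
    intro e
    split_ifs with he
    · rw [PMF.toMeasure_apply_singleton _ _ (by measurability), PMF.bernoulli_apply]
      have h1 : Real.toNNReal p ≤ 1 := by simpa using hp1.le
      rw [Bool.cond_false, hpp, ENNReal.coe_toReal, NNReal.coe_sub h1]
      simp [hp0.le]
    · rw [measure_univ, ENNReal.toReal_one]
  rw [Finset.prod_congr rfl (fun e _ => this e)]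
  simp

theorem er_indep_two {V : Type*} [Fintype V] [DecidableEq V] (p : ℝ)
    (S T : Finset (Sym2 V)) (hS : Disjoint S T) (A B : Set (Sym2 V → Bool))
    (hA : ∀ ω ω', (∀ e ∈ S, ω e = ω' e) → ω ∈ A → ω' ∈ A)
    (hB : ∀ ω ω', (∀ e ∈ T, ω e = ω' e) → ω ∈ B → ω' ∈ B) :
    (erMeasure V p).real (A ∩ B) = (erMeasure V p).real A * (erMeasure V p).real B := by
  have hind : iIndepFun (fun (e : Sym2 V) (ω : Sym2 V → Bool) => ω e) (erMeasure V p) := by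
    unfold erMeasure
    exact iIndepFun_pi (X := fun _ b => b) (fun _ => aemeasurable_id)
  have h2 := iIndepFun.indepFun_finset S T hS hind (fun i => measurable_pi_apply i)
  have key : ∀ (S : Finset (Sym2 V)) (A : Set (Sym2 V → Bool)),
      (∀ ω ω', (∀ e ∈ S, ω e = ω' e) → ω ∈ A → ω' ∈ A) →
      (fun (ω : Sym2 V → Bool) (e : S) => ω e) ⁻¹' {x | ∃ ω ∈ A, ∀ e : S, x e = ω e} = A := by
    intro S A hA
    ext ω
    constructor
    · rintro ⟨ω', h', he⟩
      exact hA ω' ω (fun e hes => (he ⟨e, hes⟩).symm) h'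
    · intro h
      exact ⟨ω, h, fun _ => rfl⟩
  have h3 := h2.measure_inter_preimage_eq_mul
    {x | ∃ ω ∈ A, ∀ e : S, x e = ω e} {x | ∃ ω ∈ B, ∀ e : T, x e = ω e}
    (Set.toFinite _).measurableSet (Set.toFinite _).measurableSet
  rw [key S A hA, key T B hB] at h3
  simp only [Measure.real]
  rw [h3, ENNReal.toReal_mul]

theorem er_indep {V : Type*} [Fintype V] [DecidableEq V] (p : ℝ)
    {J : Type*} [DecidableEq J] (R : Finset J) (S : J → Finset (Sym2 V))
    (hS : ∀ i ∈ R, ∀ j ∈ R, i ≠ j → Disjoint (S i) (S j)) (A : J → Set (Sym2 V → Bool))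
    (hA : ∀ j ∈ R, ∀ ω ω', (∀ e ∈ S j, ω e = ω' e) → ω ∈ A j → ω' ∈ A j) :
    (erMeasure V p).real (⋂ j ∈ R, A j) = ∏ j ∈ R, (erMeasure V p).real (A j) := by
  induction R using Finset.induction_on with
  | empty => simp
  | insert a R ha ih =>
    rw [Finset.set_biInter_insert, Finset.prod_insert ha,
      er_indep_two p (S a) (R.biUnion S) ?_ (A a) _ (hA a (Finset.mem_insert_self _ _)) ?_, ih]
    · exact fun i hi j hj => hS i (Finset.mem_insert_of_mem hi) j (Finset.mem_insert_of_mem hj)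
    · exact fun j hj => hA j (Finset.mem_insert_of_mem hj)
    · rw [Finset.disjoint_biUnion_right]
      intro j hj
      exact hS a (Finset.mem_insert_self _ _) j (Finset.mem_insert_of_mem hj)
        (fun h => ha (h ▸ hj))
    · intro ω ω' h hω
      simp only [Set.mem_iInter] at hω ⊢
      intro j hj
      exact hA j (Finset.mem_insert_of_mem hj) ω ω'
        (fun e he => h e (Finset.mem_biUnion.2 ⟨j, hj, he⟩)) (hω j hj)

end Jigsaw

namespace Jigsaw

/-- Sets obtained by successive pairwise merges. -/
inductive IS {V : Type*} [DecidableEq V] (Gpe Gpu : SimpleGraph V) : Finset V → Prop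
  | single (v : V) : IS Gpe Gpu {v}
  | merge (U W : Finset V) (hU : IS Gpe Gpu U) (hW : IS Gpe Gpu W) (hd : Disjoint U W)
      (h1 : SetAdj Gpe (U : Set V) W) (h2 : SetAdj Gpu (U : Set V) W) : IS Gpe Gpu (U ∪ W)

theorem SetAdj.symm' {V : Type*} {G : SimpleGraph V} {U W : Set V} (h : SetAdj G U W) :
    SetAdj G W U := by
  obtain ⟨u, hu, w, hw, ha⟩ := h
  exact ⟨w, hw, u, hu, ha.symm⟩

theorem exists_min_label {V : Type*} [Fintype V] [DecidableEq V] (Gpe Gpu : SimpleGraph V) :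
    ∃ f : V → V, (∀ v, IS Gpe Gpu (Finset.univ.filter fun u => f u = f v)) ∧
      ∀ u v, f u ≠ f v → SetAdj Gpe {x | f x = f u} {x | f x = f v} →
        ¬ SetAdj Gpu {x | f x = f u} {x | f x = f v} := by
  classical
  let P : (V → V) → Prop := fun f => ∀ v, IS Gpe Gpu (Finset.univ.filter fun u => f u = f v)
  have hne : ((Finset.univ : Finset (V → V)).filter P).Nonempty := by
    refine ⟨id, ?_⟩
    simp only [Finset.mem_filter, Finset.mem_univ, true_and]
    intro v
    have : (Finset.univ.filter fun u : V => id u = id v) = {v} := by ext; simp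
    rw [this]
    exact IS.single v
  obtain ⟨f, hf, hmin⟩ := Finset.exists_min_image _
    (fun f : V → V => (Finset.univ.image f).card) hne
  simp only [Finset.mem_filter, Finset.mem_univ, true_and] at hf hmin
  refine ⟨f, hf, ?_⟩
  intro a b hab h1 h2
  let g : V → V := fun x => if f x = f b then f a else f x
  have hg : P g := by
    intro v
    by_cases hv : f v = f a ∨ f v = f b
    · have hgv : g v = f a := by
        simp only [g]; split_ifs with h
        · rfl
        · tauto
      have : (Finset.univ.filter fun u => g u = g v) =
          (Finset.univ.filter fun u => f u = f a) ∪ (Finset.univ.filter fun u => f u = f b) := by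
        ext x
        simp only [Finset.mem_filter, Finset.mem_univ, true_and, Finset.mem_union, hgv]
        simp only [g]; split_ifs with h <;> simp [h]
      rw [this]
      refine IS.merge _ _ (hf a) (hf b) ?_ (by simpa using h1) (by simpa using h2)
      rw [Finset.disjoint_left]
      intro x hx hx'
      simp only [Finset.mem_filter, Finset.mem_univ, true_and] at hx hx'
      exact hab (hx.symm.trans hx')
    · push Not at hv
      have : (Finset.univ.filter fun u => g u = g v) =
          (Finset.univ.filter fun u => f u = f v) := by
        ext x
        simp only [Finset.mem_filter, Finset.mem_univ, true_and, g, if_neg hv.2]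
        split_ifs with h
        · rw [h]
          exact ⟨fun h' => absurd h'.symm hv.1, fun h' => absurd h'.symm hv.2⟩
        · rfl
      rw [this]; exact hf v
  have hlt : (Finset.univ.image g).card < (Finset.univ.image f).card := by
    apply Finset.card_lt_card
    rw [Finset.ssubset_iff_of_subset]
    · refine ⟨f b, Finset.mem_image_of_mem _ (Finset.mem_univ _), ?_⟩
      simp only [Finset.mem_image, Finset.mem_univ, true_and, not_exists, g]
      intro x
      split_ifs with h
      · exact hab
      · exact h
    · intro y hy
      simp only [Finset.mem_image, Finset.mem_univ, true_and] at hy ⊢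
      obtain ⟨x, rfl⟩ := hy
      simp only [g]
      split_ifs
      · exact ⟨a, rfl⟩
      · exact ⟨x, rfl⟩
  exact absurd (hmin g hg) (not_le.2 hlt)

theorem clusters_label {V : Type*} [Fintype V] [DecidableEq V] (Gpe Gpu : SimpleGraph V)
    (f : V → V)
    (hf : ∀ u v, f u ≠ f v → SetAdj Gpe {x | f x = f u} {x | f x = f v} →
        ¬ SetAdj Gpu {x | f x = f u} {x | f x = f v}) (i : ℕ) :
    ∀ S ∈ clusters Gpe Gpu i, ∀ u ∈ S, ∀ v ∈ S, f u = f v := by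
  induction i with
  | zero =>
    rintro S ⟨w, rfl⟩ u hu v hv
    rw [Set.mem_singleton_iff] at hu hv
    rw [hu, hv]
  | succ i ih =>
    rintro S ⟨cc, rfl⟩ u ⟨U, ⟨hU, hUc⟩, hu⟩ v ⟨W, ⟨hW, hWc⟩, hv⟩
    have hr : (clusterGraph Gpe Gpu (clusters Gpe Gpu i)).Reachable ⟨U, hU⟩ ⟨W, hW⟩ :=
      SimpleGraph.ConnectedComponent.exact (hUc.trans hWc.symm)
    have key : ∀ (A B : clusters Gpe Gpu i)
        (_ : (clusterGraph Gpe Gpu (clusters Gpe Gpu i)).Walk A B),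
        ∀ u ∈ A.1, ∀ v ∈ B.1, f u = f v := by
      intro A B w
      induction w with
      | nil => exact ih _ (Subtype.property _)
      | cons h w ih' =>
        rename_i A B C
        intro u hu v hv
        obtain ⟨_, ⟨a, ha, b, hb, hab⟩, ⟨c, hc, d, hd, hcd⟩⟩ := h
        rw [← ih' d hd v hv]
        by_contra hne
        have e1 := fun x hx => ih A.1 A.2 x hx u hu
        have e2 := fun x hx => ih B.1 B.2 x hx d hd
        exact hf u d hne ⟨a, e1 a ha, b, e2 b hb, hab⟩ ⟨c, e1 c hc, d, rfl, hcd⟩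
    exact key _ _ hr.some u hu v hv

theorem Solves.isUniv {V : Type*} [Fintype V] [DecidableEq V] [Nonempty V] {Gpe Gpu : SimpleGraph V}
    (h : Solves Gpe Gpu) : IS Gpe Gpu Finset.univ := by
  obtain ⟨f, hf, hf2⟩ := exists_min_label Gpe Gpu
  obtain ⟨i, hi⟩ := h
  have := clusters_label Gpe Gpu f hf2 i Set.univ (by rw [hi]; rfl)
  obtain ⟨v⟩ := ‹Nonempty V›
  have h2 := hf v
  rwa [Finset.filter_true_of_mem] at h2
  intro u _
  exact this u trivial v trivial

theorem IS.scale {V : Type*} [DecidableEq V] {Gpe Gpu : SimpleGraph V} {U : Finset V}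
    (h : IS Gpe Gpu U) (k : ℕ) (hk : k ≤ U.card) (hk1 : 1 ≤ k) :
    ∃ W, IS Gpe Gpu W ∧ k ≤ W.card ∧ W.card < 2 * k := by
  induction h with
  | single v => exact ⟨_, IS.single v, hk, by simp; omega⟩
  | merge U W hU hW hd h1 h2 ihU ihW =>
    by_cases hu : k ≤ U.card
    · exact ihU hu
    by_cases hw : k ≤ W.card
    · exact ihW hw
    refine ⟨_, IS.merge U W hU hW hd h1 h2, hk, ?_⟩
    have := Finset.card_union_le U W
    omega

theorem IS.edges {V : Type*} [DecidableEq V] {ω : Sym2 V → Bool} {Gpu : SimpleGraph V}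
    {U : Finset V} (h : IS (graphOf ω) Gpu U) :
    ∃ E : Finset (Sym2 V), E.card + 1 = U.card ∧ ∀ e ∈ E, ω e = true ∧ e ∈ U.sym2 ∧ ¬ e.IsDiag := by
  induction h with
  | single v => exact ⟨∅, by simp⟩
  | merge U W hU hW hd h1 h2 ihU ihW =>
    obtain ⟨E, hE, hE'⟩ := ihU
    obtain ⟨F, hF, hF'⟩ := ihW
    obtain ⟨u, hu, w, hw, huw, hω⟩ := h1
    have hEF : Disjoint E F := by
      rw [Finset.disjoint_left]
      intro e he hf
      have a := (hE' e he).2.1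
      have b := (hF' e hf).2.1
      induction e with
      | _ x y =>
        rw [Finset.mk_mem_sym2_iff] at a b
        exact Finset.disjoint_left.1 hd a.1 b.1
    have hn : s(u, w) ∉ E ∪ F := by
      rw [Finset.mem_union]
      rintro (h | h)
      · have := (hE' _ h).2.1
        rw [Finset.mk_mem_sym2_iff] at this
        exact Finset.disjoint_left.1 hd this.2 hw
      · have := (hF' _ h).2.1
        rw [Finset.mk_mem_sym2_iff] at this
        exact Finset.disjoint_left.1 hd hu this.1
    refine ⟨insert s(u, w) (E ∪ F), ?_, ?_⟩
    · rw [Finset.card_insert_of_notMem hn, Finset.card_union_of_disjoint hEF,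
        Finset.card_union_of_disjoint hd]
      omega
    · intro e he
      rw [Finset.mem_insert, Finset.mem_union] at he
      rcases he with rfl | he | he
      · refine ⟨hω, ?_, by simpa using huw⟩
        rw [Finset.mk_mem_sym2_iff]
        exact ⟨Finset.mem_union_left _ hu, Finset.mem_union_right _ hw⟩
      · exact ⟨(hE' e he).1, Finset.sym2_mono Finset.subset_union_left (hE' e he).2.1, (hE' e he).2.2⟩
      · exact ⟨(hF' e he).1, Finset.sym2_mono Finset.subset_union_right (hF' e he).2.1, (hF' e he).2.2⟩

/-- The arc of length `l` starting at `a`. -/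
def arc (n a l : ℕ) : Finset (Fin n) :=
  Finset.univ.filter fun x => ∃ i < l, (a + i) % n = x

theorem arc_union {n : ℕ} (a b l m : ℕ) (hd : Disjoint (arc n a l) (arc n b m))
    (u v : Fin n) (hu : u ∈ arc n a l) (hv : v ∈ arc n b m) (huv : ((u : ℕ) + 1) % n = v) :
    arc n a l ∪ arc n b m = arc n a (l + m) := by
  have hn : 0 < n := u.pos
  simp only [arc, Finset.mem_filter, Finset.mem_univ, true_and] at hu hv
  obtain ⟨i, hi, hiu⟩ := hu
  obtain ⟨j, hj, hjv⟩ := hv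
  have e1 : (a + (i + 1)) % n = v := by
    rw [← huv, ← hiu, ← add_assoc]; simp
  have hil : i + 1 = l := by
    by_contra hne
    refine Finset.disjoint_left.1 hd (?_ : v ∈ _) ?_
    · simp only [arc, Finset.mem_filter, Finset.mem_univ, true_and]
      exact ⟨i + 1, by omega, e1⟩
    · simp only [arc, Finset.mem_filter, Finset.mem_univ, true_and]
      exact ⟨j, hj, hjv⟩
  have hj0 : j = 0 := by
    by_contra hne
    refine Finset.disjoint_left.1 hd (?_ : u ∈ _) ?_
    · simp only [arc, Finset.mem_filter, Finset.mem_univ, true_and]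
      exact ⟨i, hi, hiu⟩
    · simp only [arc, Finset.mem_filter, Finset.mem_univ, true_and]
      refine ⟨j - 1, by omega, ?_⟩
      have h3 : (b + (j - 1) + 1) ≡ (a + i) + 1 [MOD n] := by
        show _ % n = _ % n
        rw [show b + (j - 1) + 1 = b + j by omega, hjv, ← e1, add_assoc]
      have h4 := Nat.ModEq.add_right_cancel' 1 h3
      rw [← hiu]; exact h4
  subst hj0
  have hb : b ≡ a + l [MOD n] := by
    show _ % n = _ % n
    rw [add_zero] at hjv
    rw [hjv, ← hil, e1]
  ext x
  simp only [arc, Finset.mem_filter, Finset.mem_univ, true_and, Finset.mem_union]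
  constructor
  · rintro (⟨t, ht, h⟩ | ⟨t, ht, h⟩)
    · exact ⟨t, by omega, h⟩
    · refine ⟨l + t, by omega, ?_⟩
      rw [← h, ← add_assoc]
      exact (hb.add_right t).symm
  · rintro ⟨t, ht, h⟩
    by_cases htl : t < l
    · exact Or.inl ⟨t, htl, h⟩
    · refine Or.inr ⟨t - l, by omega, ?_⟩
      rw [← h]
      have := hb.add_right (t - l)
      rw [show a + l + (t - l) = a + t by omega] at this
      exact this

theorem IS.isArc {n : ℕ} {G : SimpleGraph (Fin n)} {U : Finset (Fin n)}
    (h : IS G (ringGraph n) U) : ∃ a : Fin n, U = arc n a U.card := by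
  induction h with
  | single v =>
    refine ⟨v, ?_⟩
    ext x
    simp only [Finset.mem_singleton, Finset.card_singleton, arc, Finset.mem_filter,
      Finset.mem_univ, true_and]
    constructor
    · rintro rfl
      exact ⟨0, by omega, by simp [Nat.mod_eq_of_lt]⟩
    · rintro ⟨i, hi, h⟩
      have : i = 0 := by omega
      subst this
      rw [add_zero, Nat.mod_eq_of_lt v.2] at h
      exact Fin.ext h.symm
  | merge U W hU hW hd h1 h2 ihU ihW =>
    obtain ⟨a, ha⟩ := ihU
    obtain ⟨b, hb⟩ := ihW
    obtain ⟨u, hu, w, hw, hne, huw⟩ := h2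
    rw [Finset.mem_coe] at hu hw
    have hc := Finset.card_union_of_disjoint hd
    rcases huw with h | h
    · refine ⟨a, ?_⟩
      have := arc_union a b U.card W.card (by rwa [← ha, ← hb]) u w (by rwa [← ha])
        (by rwa [← hb]) h
      rw [← ha, ← hb] at this
      rw [hc]; exact this
    · refine ⟨b, ?_⟩
      have := arc_union b a W.card U.card (by rw [← ha, ← hb]; exact hd.symm) w u (by rwa [← hb])
        (by rwa [← ha]) h
      rw [← ha, ← hb] at this
      rw [hc, Finset.union_comm, add_comm]; exact this

theorem solve_lower_det {n : ℕ} (hn : 0 < n) (k : ℕ) (hk : 1 ≤ k) (hkn : k ≤ n)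
    (ω : Sym2 (Fin n) → Bool) (h : Solves (graphOf ω) (ringGraph n)) :
    ∃ a : Fin n, ∃ l ∈ Finset.Ico k (2 * k), (arc n a l).card = l ∧
      ∃ E ∈ ((arc n a l).sym2.filter fun e => ¬ e.IsDiag).powersetCard (l - 1),
        ∀ e ∈ E, ω e = true := by
  haveI : Nonempty (Fin n) := ⟨⟨0, hn⟩⟩
  obtain ⟨W, hW, h1, h2⟩ := h.isUniv.scale k (by simpa using hkn) hk
  obtain ⟨a, ha⟩ := hW.isArc
  obtain ⟨E, hE, hE'⟩ := hW.edges
  refine ⟨a, W.card, Finset.mem_Ico.2 ⟨h1, h2⟩, by rw [← ha], E, ?_, fun e he => (hE' e he).1⟩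
  rw [Finset.mem_powersetCard, ← ha]
  refine ⟨fun e he => Finset.mem_filter.2 (hE' e he).2, by omega⟩

end Jigsaw

namespace Jigsaw

theorem card_nondiag {n : ℕ} (s : Finset (Fin n)) :
    (s.sym2.filter fun e => ¬ e.IsDiag).card ≤ s.card.choose 2 := by
  rw [← Sym2.card_image_offDiag]
  apply Finset.card_le_card
  intro e he
  rw [Finset.mem_filter] at he
  obtain ⟨h1, h2⟩ := he
  induction e with
  | _ x y =>
    rw [Finset.mk_mem_sym2_iff] at h1
    rw [Finset.mem_image]
    exact ⟨(x, y), by rw [Finset.mem_offDiag]; exact ⟨h1.1, h1.2, by simpa using h2⟩, rfl⟩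

theorem lower_prob {n : ℕ} (hn : 0 < n) (k : ℕ) (hk : 1 ≤ k) (hkn : k ≤ n) {p : ℝ}
    (hp0 : 0 < p) (hp1 : p < 1) :
    (erMeasure (Fin n) p).real {ω | Solves (graphOf ω) (ringGraph n)} ≤
      n * ∑ l ∈ Finset.Ico k (2 * k), ((l.choose 2).choose (l - 1) : ℝ) * p ^ (l - 1) := by
  set μ := erMeasure (Fin n) p
  let Es : Fin n → ℕ → Finset (Finset (Sym2 (Fin n))) := fun a l =>
    if (arc n a l).card = l then
      ((arc n a l).sym2.filter fun e => ¬ e.IsDiag).powersetCard (l - 1) else ∅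
  have hsub : {ω | Solves (graphOf ω) (ringGraph n)} ⊆
      ⋃ a ∈ (Finset.univ : Finset (Fin n)), ⋃ l ∈ Finset.Ico k (2 * k), ⋃ E ∈ Es a l,
        {ω | ∀ e ∈ E, ω e = true} := by
    intro ω hω
    obtain ⟨a, l, hl, hc, E, hE, h⟩ := solve_lower_det hn k hk hkn ω hω
    simp only [Set.mem_iUnion]
    refine ⟨a, Finset.mem_univ _, l, hl, E, ?_, h⟩
    simp only [Es, if_pos hc]
    exact hE
  refine (measureReal_mono hsub (measure_ne_top _ _)).trans ?_
  refine (measureReal_biUnion_finset_le _ _).trans ?_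
  have : ∀ a ∈ (Finset.univ : Finset (Fin n)), μ.real (⋃ l ∈ Finset.Ico k (2 * k), ⋃ E ∈ Es a l,
        {ω | ∀ e ∈ E, ω e = true}) ≤
      ∑ l ∈ Finset.Ico k (2 * k), ((l.choose 2).choose (l - 1) : ℝ) * p ^ (l - 1) := by
    intro a _
    refine (measureReal_biUnion_finset_le _ _).trans ?_
    refine Finset.sum_le_sum fun l hl => ?_
    refine (measureReal_biUnion_finset_le _ _).trans ?_
    have h1 : ∀ E ∈ Es a l, μ.real {ω | ∀ e ∈ E, ω e = true} = p ^ (l - 1) := by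
      intro E hE
      rw [er_forall_true hp0 hp1]
      simp only [Es] at hE
      split_ifs at hE
      · rw [(Finset.mem_powersetCard.1 hE).2]
      · simp at hE
    rw [Finset.sum_congr rfl h1, Finset.sum_const, nsmul_eq_mul]
    gcongr
    simp only [Es]
    split_ifs with hc
    · rw [Finset.card_powersetCard]
      apply Nat.choose_le_choose
      have := card_nondiag (arc n a l)
      rwa [hc] at this
    · simp
  refine (Finset.sum_le_sum this).trans ?_
  simp

theorem choose_bound (l : ℕ) (hl : 1 ≤ l) {p : ℝ} (hp0 : 0 < p) :
    ((l.choose 2).choose (l - 1) : ℝ) * p ^ (l - 1) ≤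
      (Real.exp 1 * l * p / 2) ^ (l - 1) := by
  obtain ⟨r, rfl⟩ : ∃ r, l = r + 1 := ⟨l - 1, by omega⟩
  simp only [Nat.add_sub_cancel]
  have h1 := Nat.choose_le_pow_div (α := ℝ) r ((r + 1).choose 2)
  have h2 := Real.pow_div_factorial_le_exp (r : ℝ) (by positivity) r
  have h3 : (((r + 1).choose 2 : ℕ) : ℝ) = r * ((r + 1 : ℕ) / 2 : ℝ) := by
    rw [Nat.cast_choose_two]; push_cast; ring
  calc (((r + 1).choose 2).choose r : ℝ) * p ^ r
      ≤ ((((r + 1).choose 2 : ℕ) : ℝ) ^ r / r.factorial) * p ^ r := by gcongr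
    _ = ((r : ℝ) ^ r / r.factorial) * ((r + 1 : ℕ) / 2 * p) ^ r := by
        rw [h3]; simp only [mul_pow]; ring
    _ ≤ Real.exp r * ((r + 1 : ℕ) / 2 * p) ^ r := by gcongr
    _ = _ := by
        rw [show (r : ℝ) = r * 1 by ring, Real.exp_nat_mul, ← mul_pow]; congr 1; push_cast; ring

theorem lower_bound : ∀ᶠ n : ℕ in atTop, ∀ p : ℝ, 0 < p → p < 1 → p < 1 / (27 * Real.log n) →
    (erMeasure (Fin n) p).real {ω | Solves (graphOf ω) (ringGraph n)} < 1 / 2 := by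
  have hlog : Tendsto (fun n : ℕ => Real.log n) atTop atTop :=
    Real.tendsto_log_atTop.comp tendsto_natCast_atTop_atTop
  have hlim : Tendsto (fun L : ℝ => 2 * Real.exp (3 / 2) * (L * Real.exp (-(1 / 2) * L))) atTop
      (𝓝 (2 * Real.exp (3 / 2) * 0)) := by
    apply Tendsto.const_mul
    have := Real.tendsto_pow_mul_exp_neg_atTop_nhds_zero 1
    have h2 := (this.comp (tendsto_id.const_mul_atTop (show (0 : ℝ) < 1 / 2 by norm_num))).const_mul 2
    rw [mul_zero] at h2
    refine h2.congr fun L => ?_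
    simp only [Function.comp, id, pow_one]
    rw [show -(1 / 2 * L) = -(1 / 2) * L by ring]
    ring
  rw [mul_zero] at hlim
  have hev := (hlim.comp hlog).eventually (gt_mem_nhds (show (0 : ℝ) < 1 / 2 by norm_num))
  filter_upwards [hev, hlog.eventually_ge_atTop 1, eventually_ge_atTop 1] with n h1 hL hn p hp0 hp1 hp
  simp only [Function.comp] at h1
  set L := Real.log n with hLdef
  have hn0 : (0 : ℝ) < n := by exact_mod_cast hn
  have hexp : Real.exp L = n := Real.exp_log hn0
  set k := ⌈L⌉₊ with hk
  have hk1 : L ≤ k := Nat.le_ceil L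
  have hk2 : (k : ℝ) < L + 1 := Nat.ceil_lt_add_one (by linarith)
  have hkpos : 1 ≤ k := by
    have : (1 : ℝ) ≤ k := by linarith
    exact_mod_cast this
  have hkn : k ≤ n := by
    apply Nat.ceil_le.2
    rw [← hexp]
    have := Real.add_one_le_exp L
    linarith
  refine (lower_prob hn k hkpos hkn hp0 hp1).trans_lt (lt_of_le_of_lt ?_ h1)
  have hterm : ∀ l ∈ Finset.Ico k (2 * k),
      ((l.choose 2).choose (l - 1) : ℝ) * p ^ (l - 1) ≤ Real.exp (-(3 / 2) * (L - 1)) := by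
    intro l hl
    rw [Finset.mem_Ico] at hl
    refine (choose_bound l (by omega) hp0).trans ?_
    have hl2 : (l : ℝ) ≤ 3 * L := by
      have : (l : ℝ) + 1 ≤ 2 * k := by exact_mod_cast hl.2
      linarith
    have hpL : p * L ≤ 1 / 27 := by
      rw [lt_div_iff₀ (by positivity)] at hp
      linarith
    have he := Real.exp_one_lt_d9
    have hq : Real.exp 1 * l * p / 2 ≤ 1 / 6 := by
      have h4 : (l : ℝ) * p ≤ 1 / 9 := by nlinarith
      have h5 : Real.exp 1 * (l * p) ≤ 3 * (1 / 9) := by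
        apply mul_le_mul (by linarith) h4 (by positivity) (by norm_num)
      linarith
    have hq2 : (1 / 6 : ℝ) ≤ Real.exp (-(3 / 2)) := by
      rw [Real.exp_neg, ← one_div]
      apply one_div_le_one_div_of_le (Real.exp_pos _)
      have h6 : Real.exp (1 / 2) ≤ 2 := by
        have : Real.exp (1 / 2) ^ 2 = Real.exp 1 := by
          rw [← Real.exp_nat_mul]; norm_num
        nlinarith [Real.exp_pos (1 / 2)]
      rw [show (3 / 2 : ℝ) = 1 + 1 / 2 by norm_num, Real.exp_add]
      nlinarith [Real.exp_pos (1 / 2)]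
    calc (Real.exp 1 * l * p / 2) ^ (l - 1) ≤ Real.exp (-(3 / 2)) ^ (l - 1) := by
          apply pow_le_pow_left₀ (by positivity) (hq.trans hq2)
      _ = Real.exp (((l - 1 : ℕ) : ℝ) * (-(3 / 2))) := by rw [Real.exp_nat_mul]
      _ ≤ _ := by
          apply Real.exp_le_exp.2
          have : (k : ℝ) ≤ ((l - 1 : ℕ) : ℝ) + 1 := by exact_mod_cast (by omega : k ≤ l - 1 + 1)
          linarith
  calc (n : ℝ) * ∑ l ∈ Finset.Ico k (2 * k), ((l.choose 2).choose (l - 1) : ℝ) * p ^ (l - 1)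
      ≤ n * ∑ l ∈ Finset.Ico k (2 * k), Real.exp (-(3 / 2) * (L - 1)) := by
        gcongr with l hl
        exact hterm l hl
    _ = n * (k * Real.exp (-(3 / 2) * (L - 1))) := by
        rw [Finset.sum_const, Nat.card_Ico, nsmul_eq_mul]
        congr 3
        omega
    _ ≤ n * ((2 * L) * Real.exp (-(3 / 2) * (L - 1))) := by
        gcongr
        linarith
    _ = _ := by
        rw [← hexp, show -(3 / 2) * (L - 1) = 3 / 2 + -(1 / 2) * L + -L by ring, Real.exp_add,
          Real.exp_add, Real.exp_neg]
        field_simp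

end Jigsaw

namespace Jigsaw

theorem clusters_part {V : Type*} (Gpe Gpu : SimpleGraph V) (i : ℕ) :
    (∀ S ∈ clusters Gpe Gpu i, S.Nonempty) ∧ (∀ v, ∃ S ∈ clusters Gpe Gpu i, v ∈ S) ∧
    (∀ S ∈ clusters Gpe Gpu i, ∀ T ∈ clusters Gpe Gpu i, ∀ v, v ∈ S → v ∈ T → S = T) := by
  induction i with
  | zero =>
    refine ⟨?_, fun v => ⟨{v}, ⟨v, rfl⟩, rfl⟩, ?_⟩
    · rintro S ⟨v, rfl⟩
      exact ⟨v, rfl⟩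
    · rintro S ⟨a, rfl⟩ T ⟨b, rfl⟩ v hv hv'
      rw [Set.mem_singleton_iff] at hv hv'
      rw [← hv, ← hv']
  | succ i ih =>
    obtain ⟨h1, h2, h3⟩ := ih
    refine ⟨?_, ?_, ?_⟩
    · rintro S ⟨cc, rfl⟩
      induction cc using SimpleGraph.ConnectedComponent.ind with
      | _ U =>
        obtain ⟨v, hv⟩ := h1 U.1 U.2
        exact ⟨v, U.1, ⟨U.2, rfl⟩, hv⟩
    · intro v
      obtain ⟨S, hS, hv⟩ := h2 v
      exact ⟨_, ⟨(clusterGraph Gpe Gpu _).connectedComponentMk ⟨S, hS⟩, rfl⟩, S, ⟨hS, rfl⟩, hv⟩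
    · rintro S ⟨cc, rfl⟩ T ⟨cc', rfl⟩ v ⟨U, ⟨hU, hUc⟩, hu⟩ ⟨W, ⟨hW, hWc⟩, hw⟩
      obtain rfl := h3 U hU W hW v hu hw
      rw [← hUc, ← hWc]

theorem solve_of_chain {V : Type*} (Gpe Gpu : SimpleGraph V) (N : ℕ) (v : ℕ → V)
    (hsurj : ∀ x, ∃ t ≤ N, v t = x)
    (hpe : ∀ t < N, ∃ s ≤ t, Gpe.Adj (v s) (v (t + 1)))
    (hpu : ∀ t < N, ∃ s ≤ t, Gpu.Adj (v s) (v (t + 1))) : Solves Gpe Gpu := by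
  have key : ∀ t ≤ N, ∃ S ∈ clusters Gpe Gpu t, ∀ s ≤ t, v s ∈ S := by
    intro t
    induction t with
    | zero =>
      intro _
      refine ⟨{v 0}, ⟨v 0, rfl⟩, ?_⟩
      intro s hs
      rw [Nat.le_zero.1 hs]; rfl
    | succ t ih =>
      intro ht
      obtain ⟨S, hS, hs⟩ := ih (by omega)
      obtain ⟨W, hW, hw⟩ := (clusters_part Gpe Gpu t).2.1 (v (t + 1))
      obtain ⟨a, ha, hae⟩ := hpe t (by omega)
      obtain ⟨b, hb, hbe⟩ := hpu t (by omega)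
      refine ⟨_, ⟨(clusterGraph Gpe Gpu _).connectedComponentMk ⟨S, hS⟩, rfl⟩, ?_⟩
      intro s hst
      rcases Nat.lt_or_ge s (t + 1) with h | h
      · exact ⟨S, ⟨hS, rfl⟩, hs s (by omega)⟩
      · have : s = t + 1 := by omega
        subst this
        refine ⟨W, ⟨hW, ?_⟩, hw⟩
        by_cases hWS : W = S
        · subst hWS; rfl
        · apply SimpleGraph.ConnectedComponent.sound
          apply SimpleGraph.Adj.reachable
          refine ⟨fun h => hWS (congrArg Subtype.val h), ?_, ?_⟩
          · exact ⟨_, hw, _, hs a ha, hae.symm⟩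
          · exact ⟨_, hw, _, hs b hb, hbe.symm⟩
  obtain ⟨S, hS, hs⟩ := key N le_rfl
  have hSu : S = Set.univ := by
    ext x
    obtain ⟨t, ht, rfl⟩ := hsurj x
    simp [hs t ht]
  subst hSu
  refine ⟨N, ?_⟩
  obtain ⟨h1, _, h3⟩ := clusters_part Gpe Gpu N
  ext T
  rw [Set.mem_singleton_iff]
  constructor
  · intro hT
    obtain ⟨x, hx⟩ := h1 T hT
    exact h3 T hT _ hS x hx trivial
  · rintro rfl
    exact hS

/-- The vertex number `i` (cyclically) of the block `j`. -/
def vt {n : ℕ} (hn : 0 < n) (m j i : ℕ) : Fin n := ⟨(j * m + i) % n, Nat.mod_lt _ hn⟩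

theorem vt_val {n : ℕ} (hn : 0 < n) {m j i J : ℕ} (hJ : J * m ≤ n) (hj : j < J) (hi : i < m) :
    (vt hn m j i : ℕ) = j * m + i := by
  apply Nat.mod_eq_of_lt
  have : (j + 1) * m ≤ J * m := Nat.mul_le_mul_right _ hj
  rw [add_mul] at this
  omega

theorem vt_inj {n : ℕ} (hn : 0 < n) {m j i j' i' J : ℕ} (hJ : J * m ≤ n) (hj : j < J) (hi : i < m)
    (hj' : j' < J) (hi' : i' < m) (h : vt hn m j i = vt hn m j' i') : j = j' ∧ i = i' := by
  have h2 := congrArg Fin.val h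
  rw [vt_val hn hJ hj hi, vt_val hn hJ hj' hi'] at h2
  have hjj : j = j' := by
    have := congrArg (· / m) h2
    rw [mul_comm j, mul_comm j', Nat.mul_add_div (by omega), Nat.mul_add_div (by omega),
      Nat.div_eq_of_lt hi, Nat.div_eq_of_lt hi'] at this
    simpa using this
  subst hjj
  exact ⟨rfl, by omega⟩

/-- The edges from vertex `k` of block `j` to earlier vertices of the block. -/
def SE {n : ℕ} (hn : 0 < n) (m j k : ℕ) : Finset (Sym2 (Fin n)) :=
  (Finset.range k).image fun i => s(vt hn m j i, vt hn m j k)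

/-- The edges from `v` to the block `j`. -/
def BE {n : ℕ} (hn : 0 < n) (m j : ℕ) (v : Fin n) : Finset (Sym2 (Fin n)) :=
  (Finset.range m).image fun i => s(vt hn m j i, v)

theorem card_SE {n : ℕ} (hn : 0 < n) {m j k J : ℕ} (hJ : J * m ≤ n) (hj : j < J) (hk : k < m) :
    (SE hn m j k).card = k := by
  rw [SE, Finset.card_image_of_injOn, Finset.card_range]
  intro a ha b hb hab
  simp only [Finset.coe_range, Set.mem_Iio] at ha hb
  have := Sym2.congr_left.1 hab
  exact (vt_inj hn hJ hj (by omega) hj (by omega) this).2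

theorem card_BE {n : ℕ} (hn : 0 < n) {m j J : ℕ} (hJ : J * m ≤ n) (hj : j < J) (v : Fin n) :
    (BE hn m j v).card = m := by
  rw [BE, Finset.card_image_of_injOn, Finset.card_range]
  intro a ha b hb hab
  simp only [Finset.coe_range, Set.mem_Iio] at ha hb
  have := Sym2.congr_left.1 hab
  exact (vt_inj hn hJ hj (by omega) hj (by omega) this).2

theorem SE_disj {n : ℕ} (hn : 0 < n) {m j k j' k' J : ℕ} (hJ : J * m ≤ n) (hj : j < J) (hk : k < m)
    (hj' : j' < J) (hk' : k' < m) (h : ¬ (j = j' ∧ k = k')) :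
    Disjoint (SE hn m j k) (SE hn m j' k') := by
  rw [Finset.disjoint_left]
  intro e he he'
  simp only [SE, Finset.mem_image, Finset.mem_range] at he he'
  obtain ⟨i, hi, rfl⟩ := he
  obtain ⟨i', hi', h2⟩ := he'
  rcases Sym2.eq_iff.1 h2 with ⟨ha, hb⟩ | ⟨ha, hb⟩
  · have := vt_inj hn hJ hj' hk' hj hk hb
    omega
  · have h1 := vt_inj hn hJ hj' hk' hj (by omega) hb
    have h2 := vt_inj hn hJ hj' (by omega) hj (by omega) ha
    omega

theorem upper_det {n : ℕ} (hn : 3 ≤ n) {m J j : ℕ} (hJ : J * m ≤ n) (hj : j < J)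
    (ω : Sym2 (Fin n) → Bool)
    (h1 : ∀ k ∈ Finset.Ico 1 m, ¬ ∀ e ∈ SE (by omega : 0 < n) m j k, ω e = false)
    (h2 : ∀ v, ¬ ∀ e ∈ BE (by omega : 0 < n) m j v, ω e = false) :
    Solves (graphOf ω) (ringGraph n) := by
  have hn0 : 0 < n := by omega
  have hinj : ∀ s t, s < n → t < n → vt hn0 m j s = vt hn0 m j t → s = t := by
    intro s t hs ht h
    have h' : j * m + s ≡ j * m + t [MOD n] := congrArg Fin.val h
    have := Nat.ModEq.add_left_cancel' _ h'
    exact Nat.ModEq.eq_of_lt_of_lt this hs ht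
  have hmn : m ≤ n := by nlinarith
  refine solve_of_chain _ _ (n - 1) (vt hn0 m j) ?_ ?_ ?_
  · have hsurj : Function.Surjective (fun t : Fin n => vt hn0 m j t) := by
      apply Finite.surjective_of_injective
      intro s t h
      exact Fin.ext (hinj s t s.2 t.2 h)
    intro x
    obtain ⟨t, ht⟩ := hsurj x
    exact ⟨t, by omega, ht⟩
  · intro t ht
    by_cases htm : t + 1 < m
    · have := h1 (t + 1) (Finset.mem_Ico.2 ⟨by omega, htm⟩)
      push Not at this
      obtain ⟨e, he, hω⟩ := this
      simp only [SE, Finset.mem_image, Finset.mem_range] at he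
      obtain ⟨i, hi, rfl⟩ := he
      refine ⟨i, by omega, ?_, by simpa using hω⟩
      intro h
      have := hinj _ _ (by omega) (by omega) h
      omega
    · have := h2 (vt hn0 m j (t + 1))
      push Not at this
      obtain ⟨e, he, hω⟩ := this
      simp only [BE, Finset.mem_image, Finset.mem_range] at he
      obtain ⟨i, hi, rfl⟩ := he
      refine ⟨i, by omega, ?_, by simpa using hω⟩
      intro h
      have := hinj _ _ (by omega) (by omega) h
      omega
  · intro t ht
    refine ⟨t, le_rfl, ?_, Or.inl ?_⟩
    · intro h
      have := hinj _ _ (by omega) (by omega) h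
      omega
    · simp only [vt]
      rw [← add_assoc]; simp

end Jigsaw

namespace Jigsaw

theorem prod_bound {p : ℝ} (hp0 : 0 < p) (hp1 : p < 1) (m : ℕ) :
    Real.exp (-(Real.pi ^ 2 / 6 / p)) ≤ ∏ k ∈ Finset.Ico 1 m, (1 - (1 - p) ^ k) := by
  set q := 1 - p with hq
  have hq0 : 0 < q := by linarith
  have hq1 : q < 1 := by linarith
  have hlt : ∀ k, 1 ≤ k → q ^ k < 1 := fun k hk => pow_lt_one₀ hq0.le hq1 (by omega)
  have h1 : HasSum (fun j : ℕ => ∑ k ∈ Finset.Ico 1 m, (q ^ k) ^ (j + 1) / ((j : ℝ) + 1))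
      (∑ k ∈ Finset.Ico 1 m, -Real.log (1 - q ^ k)) := by
    apply hasSum_sum
    intro k hk
    apply Real.hasSum_pow_div_log_of_abs_lt_one
    rw [abs_of_pos (by positivity)]
    exact hlt k (Finset.mem_Ico.1 hk).1
  have h2 : HasSum (fun j : ℕ => (1 : ℝ) / ((j : ℝ) + 1) ^ 2 / p) (Real.pi ^ 2 / 6 / p) := by
    have := (hasSum_nat_add_iff' 1).2 hasSum_zeta_two
    simp only [Finset.range_one, Finset.sum_singleton, Nat.cast_zero] at this
    have h3 := this.div_const p
    rw [show Real.pi ^ 2 / 6 - 1 / (0 : ℝ) ^ 2 = Real.pi ^ 2 / 6 by norm_num] at h3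
    simpa only [Nat.cast_add, Nat.cast_one] using h3
  have h3 : ∑ k ∈ Finset.Ico 1 m, -Real.log (1 - q ^ k) ≤ Real.pi ^ 2 / 6 / p := by
    refine hasSum_le ?_ h1 h2
    intro j
    set x := q ^ (j + 1) with hx
    have hx0 : 0 < x := by positivity
    have hx1 : x < 1 := hlt _ (by omega)
    have e1 : ∑ k ∈ Finset.Ico 1 m, (q ^ k) ^ (j + 1) / ((j : ℝ) + 1) =
        (∑ k ∈ Finset.Ico 1 m, x ^ k) / ((j : ℝ) + 1) := by
      rw [Finset.sum_div]
      refine Finset.sum_congr rfl fun k _ => ?_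
      rw [hx, ← pow_mul, ← pow_mul, mul_comm]
    rw [e1]
    have e2 : ∑ k ∈ Finset.Ico 1 m, x ^ k ≤ x ^ 1 / (1 - x) :=
      geom_sum_Ico_le_of_lt_one hx0.le hx1
    have e3 : x ^ 1 / (1 - x) ≤ 1 / (((j : ℝ) + 1) * p) := by
      rw [div_le_div_iff₀ (by linarith) (by positivity)]
      have b1 := one_add_mul_le_pow (a := p) (by linarith) (j + 1)
      have b2 : x * (1 + p) ^ (j + 1) ≤ 1 := by
        rw [hx, ← mul_pow]
        apply pow_le_one₀ (by positivity)
        rw [hq]; nlinarith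
      push_cast at b1
      nlinarith
    calc (∑ k ∈ Finset.Ico 1 m, x ^ k) / ((j : ℝ) + 1)
        ≤ (1 / (((j : ℝ) + 1) * p)) / ((j : ℝ) + 1) := by
          gcongr
          exact e2.trans e3
      _ = _ := by field_simp
  have h4 : ∀ k ∈ Finset.Ico 1 m, 1 - q ^ k = Real.exp (Real.log (1 - q ^ k)) := by
    intro k hk
    rw [Real.exp_log]
    have := hlt k (Finset.mem_Ico.1 hk).1
    linarith
  rw [Finset.prod_congr rfl h4, ← Real.exp_sum]
  apply Real.exp_le_exp.2
  rw [Finset.sum_neg_distrib] at h3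
  linarith

theorem upper_prob {n : ℕ} (hn : 3 ≤ n) {m J : ℕ} (hJ : J * m ≤ n) {p : ℝ}
    (hp0 : 0 < p) (hp1 : p < 1) :
    1 - ((1 - ∏ k ∈ Finset.Ico 1 m, (1 - (1 - p) ^ k)) ^ J + J * (n * (1 - p) ^ m)) ≤
      (erMeasure (Fin n) p).real {ω | Solves (graphOf ω) (ringGraph n)} := by
  set μ := erMeasure (Fin n) p with hμ
  have hn0 : 0 < n := by omega
  let A : ℕ → ℕ → Set (Sym2 (Fin n) → Bool) := fun j k => {ω | ∀ e ∈ SE hn0 m j k, ω e = false}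
  let B : ℕ → Fin n → Set (Sym2 (Fin n) → Bool) := fun j v => {ω | ∀ e ∈ BE hn0 m j v, ω e = false}
  let G : ℕ → Set (Sym2 (Fin n) → Bool) := fun j => ⋂ k ∈ Finset.Ico 1 m, (A j k)ᶜ
  have hmeas : ∀ s : Set (Sym2 (Fin n) → Bool), MeasurableSet s := fun s => (Set.toFinite s).measurableSet
  have hAdep : ∀ j k ω ω', (∀ e ∈ SE hn0 m j k, ω e = ω' e) → ω ∈ (A j k)ᶜ → ω' ∈ (A j k)ᶜ := by
    intro j k ω ω' h h1 h2
    apply h1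
    intro e he
    rw [h e he]
    exact h2 e he
  have hG : ∀ j < J, μ.real (G j) = ∏ k ∈ Finset.Ico 1 m, (1 - (1 - p) ^ k) := by
    intro j hj
    simp only [G]
    rw [hμ, er_indep p (Finset.Ico 1 m) (fun k => SE hn0 m j k) ?_ (fun k => (A j k)ᶜ) ?_]
    · refine Finset.prod_congr rfl fun k hk => ?_
      rw [probReal_compl_eq_one_sub (hmeas _), er_forall_false hp0 hp1,
        card_SE hn0 hJ hj (Finset.mem_Ico.1 hk).2]
    · intro k hk k' hk' hne
      exact SE_disj hn0 hJ hj (Finset.mem_Ico.1 hk).2 hj (Finset.mem_Ico.1 hk').2 (by tauto)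
    · intro k _ ω ω'
      exact hAdep j k ω ω'
  have hGc : μ.real (⋂ j ∈ Finset.range J, (G j)ᶜ) =
      (1 - ∏ k ∈ Finset.Ico 1 m, (1 - (1 - p) ^ k)) ^ J := by
    rw [hμ, er_indep p (Finset.range J) (fun j => (Finset.Ico 1 m).biUnion (SE hn0 m j)) ?_
      (fun j => (G j)ᶜ) ?_]
    · rw [Finset.prod_congr rfl (g := fun _ => 1 - ∏ k ∈ Finset.Ico 1 m, (1 - (1 - p) ^ k))]
      · simp
      · intro j hj
        rw [probReal_compl_eq_one_sub (hmeas _), ← hμ, hG j (Finset.mem_range.1 hj)]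
    · intro j hj j' hj' hne
      rw [Finset.disjoint_biUnion_left]
      intro k hk
      rw [Finset.disjoint_biUnion_right]
      intro k' hk'
      exact SE_disj hn0 hJ (Finset.mem_range.1 hj) (Finset.mem_Ico.1 hk).2
        (Finset.mem_range.1 hj') (Finset.mem_Ico.1 hk').2 (by tauto)
    · intro j _ ω ω' h h1 h2
      apply h1
      simp only [G, Set.mem_iInter] at h2 ⊢
      intro k hk
      exact hAdep j k ω' ω (fun e he => (h e (Finset.mem_biUnion.2 ⟨k, hk, he⟩)).symm) (h2 k hk)
  have hsub : {ω | Solves (graphOf ω) (ringGraph n)}ᶜ ⊆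
      (⋂ j ∈ Finset.range J, (G j)ᶜ) ∪
        ⋃ j ∈ Finset.range J, ⋃ v ∈ (Finset.univ : Finset (Fin n)), B j v := by
    intro ω hω
    by_contra hcon
    rw [Set.mem_union, not_or] at hcon
    obtain ⟨c1, c2⟩ := hcon
    simp only [Set.mem_iInter, not_forall] at c1
    obtain ⟨j, hj, hGj⟩ := c1
    rw [Set.mem_compl_iff, not_not] at hGj
    simp only [G, Set.mem_iInter] at hGj
    simp only [Set.mem_iUnion, not_exists] at c2
    exact hω (upper_det hn hJ (Finset.mem_range.1 hj) ω (fun k hk => hGj k hk)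
      (fun v => c2 j hj v (Finset.mem_univ _)))
  have hB : μ.real (⋃ j ∈ Finset.range J, ⋃ v ∈ (Finset.univ : Finset (Fin n)), B j v) ≤
      J * (n * (1 - p) ^ m) := by
    refine (measureReal_biUnion_finset_le _ _).trans ?_
    have : ∀ j ∈ Finset.range J, μ.real (⋃ v ∈ (Finset.univ : Finset (Fin n)), B j v) ≤
        n * (1 - p) ^ m := by
      intro j hj
      refine (measureReal_biUnion_finset_le _ _).trans ?_
      rw [Finset.sum_congr rfl (g := fun _ => (1 - p) ^ m)]
      · simp
      · intro v _
        rw [hμ, er_forall_false hp0 hp1, card_BE hn0 hJ (Finset.mem_range.1 hj)]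
    refine (Finset.sum_le_sum this).trans ?_
    simp
  have h1 := (measureReal_mono (μ := μ) hsub (measure_ne_top _ _)).trans (measureReal_union_le _ _)
  rw [probReal_compl_eq_one_sub (hmeas _), hGc] at h1
  linarith

theorem upper_bound (lam : ℝ) (hlam : Real.pi ^ 2 / 6 < lam) :
    ∀ᶠ n : ℕ in atTop, ∀ p : ℝ, 0 < p → p < 1 → lam < p * Real.log n →
    1 / 2 < (erMeasure (Fin n) p).real {ω | Solves (graphOf ω) (ringGraph n)} := by
  have hlam1 : 1 < lam := by nlinarith [Real.pi_gt_three]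
  have hlog : Tendsto (fun n : ℕ => Real.log n) atTop atTop :=
    Real.tendsto_log_atTop.comp tendsto_natCast_atTop_atTop
  set α := Real.pi ^ 2 / 6 / lam with hα
  have hα1 : α < 1 := by rw [hα, div_lt_one (by linarith)]; exact hlam
  have hα0 : 0 ≤ α := by positivity
  have hlim : Tendsto (fun L : ℝ => Real.exp ((1 - α) * L) / (4 * L ^ 2)) atTop atTop := by
    have h1 := (Real.tendsto_exp_div_pow_atTop 2).comp
      (tendsto_id.const_mul_atTop (show (0 : ℝ) < 1 - α by linarith))
    have h2 := h1.const_mul_atTop (show (0 : ℝ) < (1 - α) ^ 2 / 4 by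
      have : 0 < 1 - α := by linarith
      positivity)
    refine h2.congr fun L => ?_
    simp only [Function.comp, id]
    have : (1 - α) ≠ 0 := by linarith
    field_simp
  filter_upwards [(hlim.comp hlog).eventually_ge_atTop 5, hlog.eventually_ge_atTop 4,
    eventually_ge_atTop 3] with n h1 hL hn p hp0 hp1 hp
  simp only [Function.comp] at h1
  set L := Real.log n with hLdef
  have hn0 : (0 : ℝ) < n := by exact_mod_cast (by omega : 0 < n)
  have hexp : Real.exp L = n := Real.exp_log hn0
  have hL0 : 0 < L := by linarith
  set m := ⌈3 * L ^ 2⌉₊ with hm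
  have hm1 : 3 * L ^ 2 ≤ m := Nat.le_ceil _
  have hm2 : (m : ℝ) < 3 * L ^ 2 + 1 := Nat.ceil_lt_add_one (by positivity)
  have hm3 : (m : ℝ) ≤ 4 * L ^ 2 := by nlinarith
  have hm0 : (0 : ℝ) < m := by nlinarith
  have hmn : 0 < m := by exact_mod_cast hm0
  refine lt_of_lt_of_le ?_ (upper_prob hn (Nat.div_mul_le_self n m) hp0 hp1)
  set J := n / m with hJ
  set Q := ∏ k ∈ Finset.Ico 1 m, (1 - (1 - p) ^ k) with hQ
  have hQ0 : Real.exp (-(α * L)) ≤ Q := by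
    refine le_trans (Real.exp_le_exp.2 ?_) (prod_bound hp0 hp1 m)
    apply neg_le_neg
    rw [hα, div_le_iff₀ hp0, div_mul_eq_mul_div, div_mul_eq_mul_div, le_div_iff₀ (by linarith)]
    have : 0 ≤ Real.pi ^ 2 / 6 := by positivity
    nlinarith
  have hQ1 : Q ≤ 1 := by
    apply Finset.prod_le_one
    · intro k _
      have : (1 - p) ^ k ≤ 1 := pow_le_one₀ (by linarith) (by linarith)
      linarith
    · intro k _
      have : 0 ≤ (1 - p) ^ k := pow_nonneg (by linarith) _
      linarith
  have hJ1 : (n : ℝ) / m - 1 ≤ J := by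
    have : n < m * (J + 1) := Nat.lt_mul_div_succ n hmn
    have h2 : (n : ℝ) < m * (J + 1) := by exact_mod_cast this
    rw [sub_le_iff_le_add, div_le_iff₀ hm0]
    linarith
  have hJn : (J : ℝ) ≤ n := by exact_mod_cast Nat.div_le_self n m
  have e14 : Real.exp (-4) < 1 / 4 := by
    rw [Real.exp_neg, ← one_div]
    apply one_div_lt_one_div_of_lt (by norm_num)
    have := Real.add_one_lt_exp (show (4 : ℝ) ≠ 0 by norm_num)
    linarith
  have t1 : (1 - Q) ^ J < 1 / 4 := by
    have a1 : 1 - Q ≤ Real.exp (-Q) := by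
      have := Real.add_one_le_exp (-Q); linarith
    have a2 : (1 - Q) ^ J ≤ Real.exp (-(Q * J)) := by
      calc (1 - Q) ^ J ≤ Real.exp (-Q) ^ J := pow_le_pow_left₀ (by linarith) a1 _
        _ = _ := by rw [← Real.exp_nat_mul]; congr 1; ring
    refine lt_of_le_of_lt (a2.trans (Real.exp_le_exp.2 ?_)) e14
    have a3 : Real.exp (-(α * L)) * ((n : ℝ) / m - 1) ≤ Q * J :=
      (mul_le_mul_of_nonneg_left hJ1 (Real.exp_pos _).le).trans
        (mul_le_mul_of_nonneg_right hQ0 (Nat.cast_nonneg _))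
    have a4 : Real.exp (-(α * L)) ≤ 1 := by
      rw [Real.exp_le_one_iff]
      have : 0 ≤ α * L := by positivity
      linarith
    have a5 : Real.exp ((1 - α) * L) / (4 * L ^ 2) ≤ Real.exp (-(α * L)) * ((n : ℝ) / m) := by
      rw [← hexp, ← mul_div_assoc, ← Real.exp_add, show -(α * L) + L = (1 - α) * L by ring]
      gcongr
    linarith
  have t2 : (J : ℝ) * (n * (1 - p) ^ m) < 1 / 4 := by
    have b1 : (1 - p) ^ m ≤ Real.exp (-(p * m)) := by
      have := Real.add_one_le_exp (-p)
      calc (1 - p) ^ m ≤ Real.exp (-p) ^ m := pow_le_pow_left₀ (by linarith) (by linarith) _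
        _ = _ := by rw [← Real.exp_nat_mul]; congr 1; ring
    have b2 : 3 * L ≤ p * m := by
      have : p * (3 * L ^ 2) ≤ p * m := by gcongr
      nlinarith
    have b3 : (1 - p) ^ m ≤ Real.exp (-(3 * L)) := b1.trans (Real.exp_le_exp.2 (by linarith))
    calc (J : ℝ) * (n * (1 - p) ^ m) ≤ n * (n * Real.exp (-(3 * L))) := by
          gcongr
      _ = Real.exp (-L) := by
          rw [← hexp, ← Real.exp_add, ← Real.exp_add]; congr 1; ring
      _ ≤ Real.exp (-4) := Real.exp_le_exp.2 (by linarith)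
      _ < 1 / 4 := e14
  linarith

end Jigsaw



open MeasureTheory Filter Topology

/-- For the ring puzzle, the critical value (the `p` at which the
probability of solving equals `1/2`) satisfies `p_c(n) ≥ 1/(27 log n)` for all large
`n`, and `limsup p_c(n) · log n ≤ π²/6`. -/
theorem jigsaw_ring_critical (pc : ℕ → ℝ)
    (hpc : ∀ n, 3 ≤ n → pc n ∈ Set.Ioo (0 : ℝ) 1 ∧
      Jigsaw.erMeasure (Fin n) (pc n)
        {ω | Jigsaw.Solves (Jigsaw.graphOf ω) (Jigsaw.ringGraph n)} = 1 / 2) :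
    (∀ᶠ n : ℕ in atTop, 1 / (27 * Real.log n) ≤ pc n) ∧
      limsup (fun n : ℕ => pc n * Real.log n) atTop ≤ Real.pi ^ 2 / 6 := by
  have hreal : ∀ n, 3 ≤ n → (Jigsaw.erMeasure (Fin n) (pc n)).real
        {ω | Jigsaw.Solves (Jigsaw.graphOf ω) (Jigsaw.ringGraph n)} = 1 / 2 := by
    intro n hn
    rw [Measure.real, (hpc n hn).2]
    simp
  constructor
  · filter_upwards [Jigsaw.lower_bound, eventually_ge_atTop 3] with n h hn
    by_contra hlt
    have h2 := h (pc n) (hpc n hn).1.1 (hpc n hn).1.2 (not_le.1 hlt)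
    rw [hreal n hn] at h2
    exact lt_irrefl _ h2
  · apply le_of_forall_gt_imp_ge_of_dense
    intro lam hlam
    refine limsup_le_of_le ?_ ?_
    · refine IsCoboundedUnder.of_frequently_ge (a := 0) (Eventually.frequently ?_)
      filter_upwards [eventually_ge_atTop 3] with n hn
      exact mul_nonneg (hpc n hn).1.1.le (Real.log_natCast_nonneg n)
    · filter_upwards [Jigsaw.upper_bound lam hlam, eventually_ge_atTop 3] with n h hn
      by_contra hlt
      have h2 := h (pc n) (hpc n hn).1.1 (hpc n hn).1.2 (not_le.1 hlt)
      rw [hreal n hn] at h2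
      exact lt_irrefl _ h2
end

section
/- Fix D ≥ 1 and b > 0, with k ≥ 2 an integer such that b ∈ (1/k, 1/(k−1)). Let the puzzle graphs be any sequence of connected simple graphs on n vertices whose maximum degree is at most D for all n, and let the people graph be the Erdős–Rényi random graph G(n, p_n) with p_n = n^{−b}. Then the probability P_{p_n}(Solve) that the people graph solves the puzzle tends to 0 as n → ∞. -/
open MeasureTheory Filter Topology

open MeasureTheory Filter Topology

namespace Jigsaw

/-- Both induced graphs on `T` are connected. -/
def BiConn {V : Type*} (Gpe Gpu : SimpleGraph V) (T : Set V) : Prop :=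
  (Gpe.induce T).Connected ∧ (Gpu.induce T).Connected

theorem exists_biConn {V : Type*} [Finite V] (Gpe Gpu : SimpleGraph V) (k : ℕ) (hk : 1 ≤ k)
    (hcard : k < Nat.card V) (hs : Solves Gpe Gpu) :
    ∃ T : Set V, BiConn Gpe Gpu T ∧ k < T.ncard ∧ T.ncard ≤ 2 * k := by
  by_contra hno
  push Not at hno
  have key : ∀ i, ∀ S ∈ clusters Gpe Gpu i,
      ∃ T : Set V, BiConn Gpe Gpu T ∧ T.ncard ≤ k ∧ S ⊆ T := by
    intro i
    induction i with
    | zero =>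
      rintro S ⟨v, rfl⟩
      refine ⟨{v}, ⟨?_, ?_⟩, by simpa using hk, subset_rfl⟩
      · have : Unique ↥({v} : Set V) := Set.uniqueSingleton v
        exact ⟨fun a b => by rw [Subsingleton.elim a b]⟩
      · have : Unique ↥({v} : Set V) := Set.uniqueSingleton v
        exact ⟨fun a b => by rw [Subsingleton.elim a b]⟩
    | succ i ih =>
      rintro S ⟨cc, rfl⟩
      obtain ⟨⟨U0, hU0⟩, rfl⟩ := cc.exists_rep
      have hfin : {T : Set V | BiConn Gpe Gpu T ∧ T.ncard ≤ k ∧ U0 ⊆ T}.Finite := Set.toFinite _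
      obtain ⟨T, ⟨hT, hTk, hUT⟩, hmax⟩ := hfin.exists_maximalFor id _ (ih U0 hU0)
      refine ⟨T, hT, hTk, ?_⟩
      have hall : ∀ W : clusters Gpe Gpu i,
          (clusterGraph Gpe Gpu (clusters Gpe Gpu i)).Reachable ⟨U0, hU0⟩ W → W.1 ⊆ T := by
        intro W hW
        rw [SimpleGraph.reachable_iff_reflTransGen] at hW
        induction hW with
        | refl => exact hUT
        | @tail U W _ hadj hU =>
          obtain ⟨-, ⟨u, hu, w, hw, ha⟩, ⟨u', hu', w', hw', ha'⟩⟩ := hadj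
          obtain ⟨T', hT', hTk', hWT⟩ := ih W.1 W.2
          have hb : BiConn Gpe Gpu (T ∪ T') :=
            ⟨SimpleGraph.connected_induce_union hT.1.preconnected hT'.1.preconnected
              (hU hu) (hWT hw) ha,
             SimpleGraph.connected_induce_union hT.2.preconnected hT'.2.preconnected
              (hU hu') (hWT hw') ha'⟩
          have hc : (T ∪ T').ncard ≤ k := by
            by_contra hlt
            have := hno _ hb (not_le.mp hlt)
            have := Set.ncard_union_le T T'
            omega
          have := hmax (j := T ∪ T') ⟨hb, hc, hUT.trans Set.subset_union_left⟩
            Set.subset_union_left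
          exact hWT.trans (Set.subset_union_right.trans this)
      rintro x ⟨U, ⟨hU, hcc⟩, hx⟩
      exact hall ⟨U, hU⟩ (SimpleGraph.ConnectedComponent.exact hcc).symm hx
  obtain ⟨i, hi⟩ := hs
  obtain ⟨T, -, hTk, hsub⟩ := key i Set.univ (by rw [hi]; rfl)
  have : T = Set.univ := Set.eq_univ_of_univ_subset hsub
  rw [this, Set.ncard_univ] at hTk
  omega

/-- Ball of radius `r` about `v`. -/
noncomputable def ball {V : Type*} [Fintype V] [DecidableEq V] (G : SimpleGraph V) (v : V) :
    ℕ → Finset V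
  | 0 => {v}
  | r + 1 => ball G v r ∪ (ball G v r).biUnion fun u => (G.neighborSet u).toFinite.toFinset

theorem ball_mono {V : Type*} [Fintype V] [DecidableEq V] (G : SimpleGraph V) (v : V) :
    Monotone (ball G v) :=
  monotone_nat_of_le_succ fun _ => Finset.subset_union_left

theorem card_ball {V : Type*} [Fintype V] [DecidableEq V] (G : SimpleGraph V) (v : V) (D : ℕ)
    (hD : ∀ u, (G.neighborSet u).ncard ≤ D) (r : ℕ) : (ball G v r).card ≤ (D + 1) ^ r := by
  induction r with
  | zero => simp [ball]
  | succ r ih =>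
    have h1 : ((ball G v r).biUnion fun u => (G.neighborSet u).toFinite.toFinset).card
        ≤ (ball G v r).card * D :=
      Finset.card_biUnion_le_card_mul _ _ _ fun u _ => by
        rw [← Set.ncard_eq_toFinset_card]; exact hD u
    calc (ball G v (r + 1)).card ≤ _ := Finset.card_union_le _ _
      _ ≤ (ball G v r).card + (ball G v r).card * D := by omega
      _ = (ball G v r).card * (D + 1) := by ring
      _ ≤ (D + 1) ^ r * (D + 1) := Nat.mul_le_mul_right _ ih
      _ = _ := by ring

theorem mem_ball_of_walk {V : Type*} [Fintype V] [DecidableEq V] (G : SimpleGraph V) {v w : V}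
    (p : G.Walk w v) : w ∈ ball G v p.length := by
  induction p with
  | nil => simp [ball]
  | cons h p ih =>
    simp only [SimpleGraph.Walk.length_cons, ball, Finset.mem_union, Finset.mem_biUnion]
    right
    exact ⟨_, ih, by simpa using h.symm⟩

theorem subset_ball {V : Type*} [Fintype V] [DecidableEq V] (G : SimpleGraph V) (T : Set V)
    (hT : (G.induce T).Connected) (m : ℕ) (hm : T.ncard ≤ m) (v : V) (hv : v ∈ T) :
    T ⊆ ball G v m := by
  classical
  intro w hw
  obtain ⟨p, hp⟩ := (hT.preconnected ⟨w, hw⟩ ⟨v, hv⟩).exists_isPath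
  have hl := hp.length_lt
  rw [← Nat.card_eq_fintype_card, Nat.card_coe_set_eq] at hl
  have := mem_ball_of_walk G (p.map (SimpleGraph.Embedding.induce T).toHom)
  rw [SimpleGraph.Walk.length_map] at this
  exact ball_mono G v (by omega) this

theorem exists_edges {V : Type*} [Fintype V] [DecidableEq V] (ω : Sym2 V → Bool)
    (Gpu : SimpleGraph V) (k : ℕ) (hk : 1 ≤ k)
    (hcard : k < Nat.card V) (hs : Solves (graphOf ω) Gpu) :
    ∃ v : V, ∃ F ∈ ((ball Gpu v (2 * k)).sym2).powerset, F.card = k ∧ ∀ e ∈ F, ω e = true := by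
  classical
  obtain ⟨T, ⟨h1, h2⟩, hlt, hle⟩ := exists_biConn (graphOf ω) Gpu k hk hcard hs
  obtain ⟨v, hv⟩ : T.Nonempty := Set.nonempty_of_ncard_ne_zero (by omega)
  have hsub := subset_ball Gpu T h2 _ hle v hv
  have hE := h1.card_vert_le_card_edgeSet_add_one
  rw [Nat.card_coe_set_eq, Nat.card_eq_fintype_card, ← SimpleGraph.edgeFinset_card] at hE
  obtain ⟨F0, hF0, hF0k⟩ := Finset.exists_subset_card_eq
    (show k ≤ ((graphOf ω).induce T).edgeFinset.card by omega)
  refine ⟨v, F0.image (Sym2.map Subtype.val), ?_, ?_, ?_⟩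
  · rw [Finset.mem_powerset]
    intro e he
    obtain ⟨e0, -, rfl⟩ := Finset.mem_image.mp he
    induction e0 with
    | _ a b => 
      rw [Sym2.map_mk, Finset.mk_mem_sym2_iff]
      exact ⟨hsub a.2, hsub b.2⟩
  · rw [Finset.card_image_of_injective _ (Sym2.map.injective Subtype.val_injective), hF0k]
  · intro e he
    obtain ⟨e0, he0, rfl⟩ := Finset.mem_image.mp he
    have := hF0 he0
    induction e0 with
    | _ a b =>
      rw [SimpleGraph.mem_edgeFinset, SimpleGraph.mem_edgeSet] at this
      exact this.2

theorem measure_edges {V : Type*} [Fintype V] [DecidableEq V] (p : ℝ) (F : Finset (Sym2 V)) :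
    erMeasure V p {ω | ∀ e ∈ F, ω e = true} ≤ ENNReal.ofReal p ^ F.card := by
  have : {ω : Sym2 V → Bool | ∀ e ∈ F, ω e = true}
      = Set.pi Set.univ fun e => if e ∈ F then {true} else Set.univ := by
    ext ω
    simp only [Set.mem_setOf_eq, Set.mem_pi, Set.mem_univ, true_imp_iff]
    refine forall_congr' fun e => ?_
    split_ifs with h <;> simp [h]
  rw [this, erMeasure, Measure.pi_pi]
  calc _ = ∏ e : Sym2 V, if e ∈ F then
        ((min (Real.toNNReal p) 1 : NNReal) : ENNReal) else 1 := by
        refine Finset.prod_congr rfl fun e _ => ?_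
        split_ifs with h
        · rw [PMF.toMeasure_apply_singleton _ _ (MeasurableSet.singleton _), PMF.bernoulli_apply]
          rfl
        · exact measure_univ
    _ = ((min (Real.toNNReal p) 1 : NNReal) : ENNReal) ^ F.card := by
        simp [Finset.prod_ite_mem]
    _ ≤ _ := by
        gcongr
        exact ENNReal.coe_le_coe.mpr (min_le_left _ _)

theorem measure_solves (n D k : ℕ) (hk : 1 ≤ k) (hn : k < n) (p : ℝ) (G : SimpleGraph (Fin n))
    (hD : ∀ u, (G.neighborSet u).ncard ≤ D) :
    erMeasure (Fin n) p {ω | Solves (graphOf ω) G} ≤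
      (n : ENNReal) * ((2 ^ (((D + 1) ^ (2 * k) + 1).choose 2) : ℕ) * ENNReal.ofReal p ^ k) := by
  classical
  have hsub : {ω | Solves (graphOf ω) G} ⊆ ⋃ v ∈ (Finset.univ : Finset (Fin n)),
      ⋃ F ∈ ((ball G v (2 * k)).sym2).powerset.filter fun F => F.card = k,
        {ω : Sym2 (Fin n) → Bool | ∀ e ∈ F, ω e = true} := by
    intro ω hω
    obtain ⟨v, F, hF, hFk, h⟩ := exists_edges ω G k hk (by simpa using hn) hω
    simp only [Set.mem_iUnion]
    exact ⟨v, Finset.mem_univ v, F, Finset.mem_filter.mpr ⟨hF, hFk⟩, h⟩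
  refine (measure_mono hsub).trans ((measure_biUnion_finset_le _ _).trans ?_)
  have hone : ∀ v ∈ (Finset.univ : Finset (Fin n)),
      erMeasure (Fin n) p (⋃ F ∈ ((ball G v (2 * k)).sym2).powerset.filter fun F => F.card = k,
        {ω : Sym2 (Fin n) → Bool | ∀ e ∈ F, ω e = true}) ≤
      (2 ^ (((D + 1) ^ (2 * k) + 1).choose 2) : ℕ) * ENNReal.ofReal p ^ k := by
    intro v _
    refine (measure_biUnion_finset_le _ _).trans ?_
    refine (Finset.sum_le_card_nsmul _ _ (ENNReal.ofReal p ^ k) ?_).trans ?_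
    · intro F hF
      have := measure_edges p F
      rwa [(Finset.mem_filter.mp hF).2] at this
    · rw [nsmul_eq_mul]
      gcongr
      refine (Finset.card_filter_le _ _).trans ?_
      rw [Finset.card_powerset, Finset.card_sym2]
      exact Nat.pow_le_pow_right (by norm_num)
        (Nat.choose_le_choose 2 (Nat.succ_le_succ (card_ball G v D hD _)))
  refine (Finset.sum_le_card_nsmul _ _ _ hone).trans ?_
  simp

end Jigsaw

/-- For connected puzzles of maximum degree at most `D` and an
Erdős–Rényi people graph with `p_n = n^{-b}`, `b ∈ (1/k, 1/(k-1))`, the probability of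
solving tends to `0`. -/
theorem jigsaw_bounded_degree_lower (D : ℕ) (hD : 1 ≤ D) (b : ℝ) (hb : 0 < b)
    (k : ℕ) (hk : 2 ≤ k) (hbk : 1 / (k : ℝ) < b ∧ b < 1 / ((k : ℝ) - 1))
    (P : (n : ℕ) → SimpleGraph (Fin n)) (hconn : ∀ n, 0 < n → (P n).Connected)
    (hdeg : ∀ n, ∀ v : Fin n, ((P n).neighborSet v).ncard ≤ D) :
    Tendsto
      (fun n : ℕ =>
        Jigsaw.erMeasure (Fin n) ((n : ℝ) ^ (-b))
          {ω | Jigsaw.Solves (Jigsaw.graphOf ω) (P n)})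
      atTop (𝓝 0) := by
  set K : ℕ := 2 ^ (((D + 1) ^ (2 * k) + 1).choose 2) with hK
  have hk0 : (0 : ℝ) < k := by positivity
  have hbk1 : 1 < b * k := by
    have := hbk.1
    rwa [div_lt_iff₀ hk0] at this
  have hlim : Tendsto (fun n : ℕ => ENNReal.ofReal (K * (n : ℝ) ^ (-(b * k - 1)))) atTop (𝓝 0) := by
    have h1 : Tendsto (fun n : ℕ => (n : ℝ) ^ (-(b * k - 1))) atTop (𝓝 0) :=
      (tendsto_rpow_neg_atTop (by linarith)).comp tendsto_natCast_atTop_atTop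
    have h2 := ENNReal.tendsto_ofReal (h1.const_mul (K : ℝ))
    simpa using h2
  refine tendsto_of_tendsto_of_tendsto_of_le_of_le' tendsto_const_nhds hlim
    (Eventually.of_forall fun _ => zero_le) ?_
  filter_upwards [eventually_gt_atTop k] with n hn
  refine (Jigsaw.measure_solves n D k (by omega) hn _ (P n) (hdeg n)).trans (le_of_eq ?_)
  have hn0 : (0 : ℝ) < n := by exact_mod_cast (by omega : 0 < n)
  rw [← ENNReal.ofReal_pow (by positivity), ← hK, ← ENNReal.ofReal_natCast n,
    ← ENNReal.ofReal_natCast K, ← ENNReal.ofReal_mul (by positivity),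
    ← ENNReal.ofReal_mul (by positivity)]
  congr 1
  rw [← Real.rpow_natCast, ← Real.rpow_mul hn0.le,
    show -(b * k - 1) = 1 + (-b) * k by ring, Real.rpow_add hn0, Real.rpow_one]
  ring
end

section
/- Let the puzzle graph be the ring (n-cycle) on vertex set Z_n and let E_people be any edge set on Z_n. Fix a positive integer x. Suppose there exist integers 0 = a_0 < a_1 < ⋯ < a_k = n such that for every j = 0, 1, …, k−1 the interval I_j := [a_j + 1, a_{j+1}] is x-good and has length |I_j| ≤ x. Then the people graph does not solve the puzzle. -/
open MeasureTheory Filter Topology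

namespace Jigsaw

theorem clusters_mono {V α : Type*} (Gpe Gpu : SimpleGraph V) (f : V → α)
    (H : ∀ u w u' w', Gpu.Adj u w → Gpe.Adj u' w' → f u = f u' → f w = f w' → f u = f w)
    (i : ℕ) : ∀ U ∈ clusters Gpe Gpu i, ∀ u ∈ U, ∀ v ∈ U, f u = f v := by
  induction i with
  | zero =>
    rintro U ⟨v, rfl⟩ a ha b hb
    rw [Set.mem_singleton_iff] at ha hb
    rw [ha, hb]
  | succ i ih =>
    have key : ∀ (A B : clusters Gpe Gpu i), (clusterGraph Gpe Gpu (clusters Gpe Gpu i)).Reachable A B →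
        ∀ u ∈ A.1, ∀ v ∈ B.1, f u = f v := by
      rintro A B ⟨p⟩
      induction p with
      | nil => exact ih _ (Subtype.property _)
      | cons hadj p hp =>
        rename_i X Y Z
        intro u hu v hv
        obtain ⟨-, ⟨p', hp', q', hq', hpe⟩, ⟨r, hr, t, ht, hpu⟩⟩ := hadj
        have h1 := H r t p' q' hpu hpe (ih _ X.2 r hr p' hp') (ih _ Y.2 t ht q' hq')
        exact (ih _ X.2 u hu r hr).trans (h1.trans (hp t ht v hv))
    rintro U ⟨cc, rfl⟩ u ⟨A, ⟨hA, hAc⟩, hu⟩ v ⟨B, ⟨hB, hBc⟩, hv⟩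
    exact key ⟨A, hA⟩ ⟨B, hB⟩ (SimpleGraph.ConnectedComponent.exact (hAc.trans hBc.symm)) u hu v hv

theorem not_solves_of_set (n : ℕ) (hn : 2 ≤ n) (Gpe : SimpleGraph (ZMod n)) (T : Set (ZMod n))
    (hne : T.Nonempty)
    (hr : ∀ r ∈ T, ∀ d : ℕ, Gpe.Adj r (r + d) → ∃ e : ℕ, 0 < e ∧ e < d ∧ r + e ∈ T)
    (hl : ∀ r ∈ T, ∀ d : ℕ, Gpe.Adj r (r - d) → ∃ e : ℕ, 0 < e ∧ e < d ∧ r - e ∈ T) :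
    ¬ Solves Gpe (zmodRing n) := by
  classical
  have : NeZero n := ⟨by omega⟩
  obtain ⟨s, hs⟩ := hne
  have hex : ∀ v : ZMod n, ∃ d : ℕ, v - d ∈ T := fun v => ⟨(v - s).val, by simpa using hs⟩
  have hD : ∃ D : ZMod n → ℕ, (∀ v, v - D v ∈ T) ∧ ∀ (v : ZMod n) (e : ℕ), v - e ∈ T → D v ≤ e :=
    ⟨fun v => Nat.find (hex v), fun v => Nat.find_spec (hex v), fun v e h => Nat.find_min' _ h⟩
  obtain ⟨D, hD1, hD2⟩ := hD
  have hT : ∀ v, v ∈ T → D v = 0 := fun v hv => by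
    have := hD2 v 0 (by simpa using hv)
    omega
  have hT' : ∀ v, D v = 0 → v ∈ T := fun v hv => by
    have := hD1 v
    simpa [hv] using this
  have hsucc : ∀ v, v + 1 ∉ T → D (v + 1) = D v + 1 := by
    intro v hv
    apply le_antisymm
    · apply hD2
      have := hD1 v
      push_cast
      simpa using this
    · have h0 : D (v + 1) ≠ 0 := fun h => hv (hT' _ h)
      obtain ⟨m, hm⟩ := Nat.exists_eq_succ_of_ne_zero h0
      have h1 := hD1 (v + 1)
      rw [hm] at h1 ⊢
      push_cast at h1
      have := hD2 v m (by simpa using h1)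
      omega
  set f : ZMod n → ZMod n × Prop := fun v => (v - D v, D v = 0) with hf
  have hfT : ∀ v w, v ∈ T → f v = f w → w = v := by
    intro v w hv h
    simp only [hf, Prod.mk.injEq, eq_iff_iff] at h
    have h0 := hT v hv
    have h1 := h.2.1 h0
    simpa [h0, h1] using h.1.symm
  have H1 : ∀ v u' w', Gpe.Adj u' w' → f v = f u' → f (v + 1) = f w' → f v = f (v + 1) := by
    intro v u' w' hadj h1 h2
    by_cases hv1 : v + 1 ∈ T
    · have hw := hfT _ _ hv1 h2
      subst hw
      by_cases hv : v ∈ T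
      · have hu := hfT _ _ hv h1
        subst hu
        obtain ⟨e, he1, he2, -⟩ := hr _ hv 1 (by simpa using hadj)
        omega
      · exfalso
        have h3 : v - D v = u' - D u' := (Prod.mk.inj h1).1
        rcases le_or_gt (D u') (D v) with hle | hlt
        · have h4 : u' = (v + 1) - ((D v + 1 - D u' : ℕ) : ZMod n) := by
            rw [Nat.cast_sub (by omega)]
            push_cast
            linear_combination -h3
          obtain ⟨e, he1, he2, he3⟩ := hl _ hv1 _ (h4 ▸ hadj.symm)
          obtain ⟨m, rfl⟩ : ∃ m, e = m + 1 := ⟨e - 1, by omega⟩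
          push_cast at he3
          have h5 := hD2 v m (by simpa using he3)
          have h6 : D u' ≠ 0 := by
            intro h
            have : D v = 0 := by
              have := (Prod.mk.inj h1).2
              simpa [h] using this
            exact hv (hT' _ this)
          omega
        · have h4 : v + 1 = u' - ((D u' - (D v + 1) : ℕ) : ZMod n) := by
            rw [Nat.cast_sub (by omega)]
            push_cast
            linear_combination h3
          have := hD2 u' _ (h4 ▸ hv1)
          omega
    · have h3 := hsucc v hv1
      by_cases hv : v ∈ T
      · exfalso
        have hu := hfT _ _ hv h1
        subst hu
        have h4 : u' + 1 - D (u' + 1) = w' - D w' := (Prod.mk.inj h2).1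
        rw [h3, hT _ hv] at h4
        have h5 : w' = u' + D w' := by
          push_cast at h4
          linear_combination -h4
        obtain ⟨e, he1, he2, he3⟩ := hr _ hv (D w') (h5 ▸ hadj)
        have h6 : u' + (e : ZMod n) = w' - ((D w' - e : ℕ) : ZMod n) := by
          rw [Nat.cast_sub (by omega)]
          linear_combination -h5
        have := hD2 w' _ (h6 ▸ he3)
        omega
      · have h4 : D v ≠ 0 := fun h => hv (hT' _ h)
        simp only [hf, h3, Prod.mk.injEq, eq_iff_iff]
        refine ⟨by push_cast; ring, by simp [h4]⟩
  rintro ⟨i, hi⟩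
  have hmain := clusters_mono Gpe (zmodRing n) f (by
    rintro u w u' w' ⟨-, rfl | rfl⟩ hpe h1 h2
    · exact H1 _ _ _ hpe h1 h2
    · exact (H1 _ _ _ hpe.symm h2 h1).symm) i Set.univ (by rw [hi]; rfl) s trivial (s + 1) trivial
  have h1 := hfT _ _ hs hmain
  have : Fact (1 < n) := ⟨by omega⟩
  simp at h1

end Jigsaw

/-- If the ring `Z_n` can be cut into consecutive intervals
`I_j = [a_j + 1, a_{j+1}]`, each of length at most `x` and each `x`-good, then the
people graph does not solve the ring puzzle. -/
theorem jigsaw_ring_not_solved_of_xGood (n : ℕ) (hn : 2 ≤ n) (x : ℕ) (hx : 0 < x)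
    (Gpe : SimpleGraph (ZMod n)) (k : ℕ) (a : ℕ → ℕ)
    (h0 : a 0 = 0) (hk : a k = n)
    (hmono : ∀ j, j < k → a j < a (j + 1))
    (hlen : ∀ j, j < k → a (j + 1) - a j ≤ x)
    (hgood : ∀ j, j < k → Jigsaw.xGood Gpe x ((a j : ℤ) + 1) ((a (j + 1) : ℤ))) :
    ¬ Jigsaw.Solves Gpe (Jigsaw.zmodRing n) := by
  have hkpos : 0 < k := by
    rcases Nat.eq_zero_or_pos k with h | h
    · subst h; omega
    · exact h
  choose! u hu1 hu2 hu3 using hgood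
  apply Jigsaw.not_solves_of_set n hn Gpe {r | ∃ j, j < k ∧ r = (u j : ZMod n)}
    ⟨_, 0, hkpos, rfl⟩
  · rintro r ⟨j, hj, rfl⟩ d hadj
    have hout : (a (j + 1) : ℤ) + x < u j + d := by
      by_contra! hc
      have := hu1 j hj
      refine hu3 j hj (u j + d) (by omega) hc ?_
      push_cast
      exact hadj
    have h2 := hu2 j hj
    rcases Nat.lt_or_ge (j + 1) k with hlt | hge
    · have h3 := hu1 (j + 1) hlt
      have h4 := hu2 (j + 1) hlt
      have h5 := hlen (j + 1) hlt
      refine ⟨(u (j + 1) - u j).toNat, by omega, by omega, j + 1, hlt, ?_⟩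
      have h6 : (((u (j + 1) - u j).toNat : ℤ) : ZMod n) = ((u (j + 1) - u j : ℤ) : ZMod n) := by
        rw [Int.toNat_of_nonneg (by omega)]
      rw [Int.cast_natCast] at h6
      rw [h6]; push_cast; ring
    · have hjk : j + 1 = k := by omega
      rw [hjk, hk] at hout h2
      have h3 := hu1 0 hkpos
      have h4 := hu2 0 hkpos
      have h5 := hlen 0 hkpos
      rw [h0] at h3 h5
      refine ⟨(u 0 + n - u j).toNat, by omega, by omega, 0, hkpos, ?_⟩
      have h6 : (((u 0 + n - u j).toNat : ℤ) : ZMod n) = ((u 0 + n - u j : ℤ) : ZMod n) := by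
        rw [Int.toNat_of_nonneg (by omega)]
      rw [Int.cast_natCast] at h6
      rw [h6]; push_cast; simp
  · rintro r ⟨j, hj, rfl⟩ d hadj
    have hout : u j - d < (a j : ℤ) + 1 - x := by
      by_contra! hc
      have := hu2 j hj
      refine hu3 j hj (u j - d) hc (by omega) ?_
      push_cast
      exact hadj
    have h2 := hu1 j hj
    rcases Nat.eq_zero_or_pos j with hz | hpos
    · subst hz
      rw [h0] at hout h2
      obtain ⟨l, rfl⟩ : ∃ l, k = l + 1 := ⟨k - 1, by omega⟩
      have h3 := hu1 l (by omega)
      have h4 := hu2 l (by omega)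
      have h5 := hlen l (by omega)
      rw [hk] at h4 h5
      refine ⟨(u 0 + n - u l).toNat, by omega, by omega, l, by omega, ?_⟩
      have h6 : (((u 0 + n - u l).toNat : ℤ) : ZMod n) = ((u 0 + n - u l : ℤ) : ZMod n) := by
        rw [Int.toNat_of_nonneg (by omega)]
      rw [Int.cast_natCast] at h6
      rw [h6]; push_cast; simp
    · obtain ⟨l, rfl⟩ : ∃ l, j = l + 1 := ⟨j - 1, by omega⟩
      have h3 := hu1 l (by omega)
      have h4 := hu2 l (by omega)
      have h5 := hlen l (by omega)
      refine ⟨(u (l + 1) - u l).toNat, by omega, by omega, l, by omega, ?_⟩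
      have h6 : (((u (l + 1) - u l).toNat : ℤ) : ZMod n) = ((u (l + 1) - u l : ℤ) : ZMod n) := by
        rw [Int.toNat_of_nonneg (by omega)]
      rw [Int.cast_natCast] at h6
      rw [h6]; push_cast; ring
end

section
/- Let V be a finite vertex set with |V| = n ≥ 1 and let E_people, E_puzzle be edge sets on V. Suppose there is an enumeration v_1, v_2, …, v_n of V such that for every j ∈ {2, …, n}, v_j has a puzzle-edge to at least one vertex in {v_1, …, v_{j−1}} and v_j has a people-edge to at least one vertex in {v_1, …, v_{j−1}}. Then the people graph solves the puzzle. -/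
open MeasureTheory Filter Topology

theorem Jigsaw.clusters_partition {V : Type*} (Gpe Gpu : SimpleGraph V) (k : ℕ) :
    (∀ v : V, ∃ U ∈ Jigsaw.clusters Gpe Gpu k, v ∈ U) ∧
    (∀ U ∈ Jigsaw.clusters Gpe Gpu k, U.Nonempty) ∧
    (∀ U ∈ Jigsaw.clusters Gpe Gpu k, ∀ W ∈ Jigsaw.clusters Gpe Gpu k,
      ∀ x, x ∈ U → x ∈ W → U = W) := by
  induction k with
  | zero =>
    refine ⟨fun v => ⟨{v}, ⟨v, rfl⟩, rfl⟩, ?_, ?_⟩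
    · rintro U ⟨v, rfl⟩
      exact ⟨v, rfl⟩
    · rintro U ⟨v, rfl⟩ W ⟨w, rfl⟩ x hx hy
      rw [Set.mem_singleton_iff] at hx hy
      rw [← hx, ← hy]
  | succ k ih =>
    obtain ⟨h1, h2, h3⟩ := ih
    refine ⟨?_, ?_, ?_⟩
    · intro v
      obtain ⟨U, hU, hv⟩ := h1 v
      exact ⟨_, ⟨(Jigsaw.clusterGraph Gpe Gpu _).connectedComponentMk ⟨U, hU⟩, rfl⟩,
        U, ⟨hU, rfl⟩, hv⟩
    · rintro S ⟨cc, rfl⟩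
      induction cc using SimpleGraph.ConnectedComponent.ind with
      | _ U =>
        obtain ⟨U, hU⟩ := U
        obtain ⟨x, hx⟩ := h2 U hU
        exact ⟨x, U, ⟨hU, rfl⟩, hx⟩
    · rintro S ⟨cc, rfl⟩ T ⟨dd, rfl⟩ x ⟨U, ⟨hU, hc⟩, hxU⟩ ⟨W, ⟨hW, hd⟩, hxW⟩
      have hUW := h3 U hU W hW x hxU hxW
      subst hUW
      rw [← hc, ← hd]

/-- If there is an enumeration of `V` in which every vertex (after
the first) has a puzzle-edge and a people-edge to the set of earlier vertices, then the
people graph solves the puzzle. -/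
theorem jigsaw_solves_of_enumeration {V : Type*} [Fintype V] (n : ℕ) (hn : 1 ≤ n)
    (Gpe Gpu : SimpleGraph V) (e : Fin n ≃ V)
    (h : ∀ j : Fin n, 0 < (j : ℕ) →
      (∃ i : Fin n, i < j ∧ Gpu.Adj (e j) (e i)) ∧
      (∃ i : Fin n, i < j ∧ Gpe.Adj (e j) (e i))) :
    Jigsaw.Solves Gpe Gpu := by
  have key : ∀ k : ℕ, ∃ U ∈ Jigsaw.clusters Gpe Gpu k, ∀ i : Fin n, (i : ℕ) ≤ k → e i ∈ U := by
    intro k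
    induction k with
    | zero =>
      refine ⟨{e ⟨0, hn⟩}, ⟨_, rfl⟩, fun i hi => ?_⟩
      have : i = ⟨0, hn⟩ := Fin.ext (Nat.le_zero.mp hi)
      rw [this]
      rfl
    | succ k ih =>
      obtain ⟨U, hU, hmem⟩ := ih
      refine ⟨_, ⟨(Jigsaw.clusterGraph Gpe Gpu _).connectedComponentMk ⟨U, hU⟩, rfl⟩, ?_⟩
      intro i hi
      by_cases hik : (i : ℕ) ≤ k
      · exact ⟨U, ⟨hU, rfl⟩, hmem i hik⟩
      · obtain ⟨W, hW, hiW⟩ := (Jigsaw.clusters_partition Gpe Gpu k).1 (e i)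
        refine ⟨W, ⟨hW, ?_⟩, hiW⟩
        by_cases hWU : W = U
        · subst hWU
          rfl
        · obtain ⟨⟨a, ha, haa⟩, ⟨b, hb, hbb⟩⟩ := h i (by omega)
          rw [SimpleGraph.ConnectedComponent.eq]
          apply SimpleGraph.Adj.reachable
          have ha' : (a : ℕ) < i := ha
          have hb' : (b : ℕ) < i := hb
          exact ⟨fun hh => hWU (congrArg Subtype.val hh),
            ⟨e i, hiW, e b, hmem b (by omega), hbb⟩, ⟨e i, hiW, e a, hmem a (by omega), haa⟩⟩
  obtain ⟨U, hU, hmem⟩ := key n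
  have hall : U = Set.univ := by
    ext v
    simp only [Set.mem_univ, iff_true]
    have := hmem (e.symm v) (e.symm v).isLt.le
    rwa [Equiv.apply_symm_apply] at this
  subst hall
  refine ⟨n, ?_⟩
  obtain ⟨-, h2, h3⟩ := Jigsaw.clusters_partition Gpe Gpu n
  ext W
  rw [Set.mem_singleton_iff]
  constructor
  · intro hW
    obtain ⟨x, hx⟩ := h2 W hW
    exact h3 W hW _ hU x hx trivial
  · rintro rfl
    exact hU
end

section
/- Let V be a finite vertex set, let E_people, E_puzzle be edge sets on V with the puzzle graph (V, E_puzzle) connected, and let U ⊆ V be nonempty. Suppose U is internally solved and every vertex of V∖U has a people-edge to some vertex of U. Then the people graph solves the puzzle. -/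
open MeasureTheory Filter Topology

namespace Jigsaw

/-- The collection is a partition. -/
def PartProp {V : Type*} (C : Set (Set V)) : Prop :=
  (∀ v, ∃ A ∈ C, v ∈ A) ∧ (∀ A ∈ C, A.Nonempty) ∧
    ∀ A ∈ C, ∀ B ∈ C, ∀ x, x ∈ A → x ∈ B → A = B

theorem exists_step {V : Type*} (Gpe Gpu : SimpleGraph V) (C : Set (Set V)) (A : C) :
    ∃ B ∈ step Gpe Gpu C, ∀ A' : C, (clusterGraph Gpe Gpu C).Reachable A' A → A'.1 ⊆ B := by
  refine ⟨_, ⟨(clusterGraph Gpe Gpu C).connectedComponentMk A, rfl⟩, ?_⟩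
  intro A' h x hx
  exact ⟨A'.1, ⟨A'.2, SimpleGraph.ConnectedComponent.sound h⟩, hx⟩

theorem partProp_step {V : Type*} (Gpe Gpu : SimpleGraph V) (C : Set (Set V))
    (h : PartProp C) : PartProp (step Gpe Gpu C) := by
  obtain ⟨h1, h2, h3⟩ := h
  refine ⟨?_, ?_, ?_⟩
  · intro v
    obtain ⟨A, hA, hv⟩ := h1 v
    obtain ⟨B, hB, hsub⟩ := exists_step Gpe Gpu C ⟨A, hA⟩
    exact ⟨B, hB, hsub ⟨A, hA⟩ (SimpleGraph.Reachable.refl _) hv⟩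
  · rintro _ ⟨cc, rfl⟩
    obtain ⟨⟨A, hA⟩, rfl⟩ := cc.exists_rep
    obtain ⟨x, hx⟩ := h2 A hA
    exact ⟨x, A, ⟨hA, rfl⟩, hx⟩
  · rintro _ ⟨cc, rfl⟩ _ ⟨cc', rfl⟩ x ⟨A, ⟨hA, rfl⟩, hx⟩ ⟨B, ⟨hB, rfl⟩, hx'⟩
    have := h3 A hA B hB x hx hx'
    subst this
    rfl

theorem partProp_clusters {V : Type*} (Gpe Gpu : SimpleGraph V) (i : ℕ) :
    PartProp (clusters Gpe Gpu i) := by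
  induction i with
  | zero =>
    refine ⟨fun v => ⟨{v}, ⟨v, rfl⟩, rfl⟩, ?_, ?_⟩
    · rintro _ ⟨v, rfl⟩
      exact ⟨v, rfl⟩
    · rintro _ ⟨v, rfl⟩ _ ⟨w, rfl⟩ x hx hx'
      rw [Set.mem_singleton_iff] at hx hx'
      rw [← hx, ← hx']
  | succ i ih => exact partProp_step _ _ _ ih

theorem reachable_of_setAdj {V : Type*} (Gpe Gpu : SimpleGraph V) (C : Set (Set V))
    (A B : C) (h1 : SetAdj Gpe A.1 B.1) (h2 : SetAdj Gpu A.1 B.1) :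
    (clusterGraph Gpe Gpu C).Reachable A B := by
  by_cases h : A = B
  · rw [h]
  · exact SimpleGraph.Adj.reachable ⟨h, h1, h2⟩

theorem setAdj_mono {V : Type*} {G : SimpleGraph V} {A B A' B' : Set V}
    (h : SetAdj G A B) (hA : A ⊆ A') (hB : B ⊆ B') : SetAdj G A' B' := by
  obtain ⟨u, hu, w, hw, ha⟩ := h
  exact ⟨u, hA hu, w, hB hw, ha⟩

theorem setAdj_image {V : Type*} {G : SimpleGraph V} {U : Set V} {A B : Set U}
    (h : SetAdj (SimpleGraph.induce U G) A B) :
    SetAdj G (Set.image Subtype.val A) (Set.image Subtype.val B) := by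
  obtain ⟨u, hu, w, hw, ha⟩ := h
  exact ⟨u, ⟨u, hu, rfl⟩, w, ⟨w, hw, rfl⟩, ha⟩

theorem induced_sub {V : Type*} (Gpe Gpu : SimpleGraph V) (U : Set V) (i : ℕ) :
    ∀ S ∈ clusters (SimpleGraph.induce U Gpe) (SimpleGraph.induce U Gpu) i,
      ∃ B ∈ clusters Gpe Gpu i, Set.image Subtype.val S ⊆ B := by
  induction i with
  | zero =>
    rintro _ ⟨v, rfl⟩
    exact ⟨{v.1}, ⟨v.1, rfl⟩, by simp⟩
  | succ i ih =>
    rintro _ ⟨cc, rfl⟩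
    obtain ⟨A, rfl⟩ := cc.exists_rep
    choose f hf hsub using ih
    let F : clusters (SimpleGraph.induce U Gpe) (SimpleGraph.induce U Gpu) i →
      clusters Gpe Gpu i := fun X => ⟨f X.1 X.2, hf X.1 X.2⟩
    have key : ∀ X Y, (clusterGraph (SimpleGraph.induce U Gpe) (SimpleGraph.induce U Gpu)
        (clusters (SimpleGraph.induce U Gpe) (SimpleGraph.induce U Gpu) i)).Reachable X Y →
        (clusterGraph Gpe Gpu (clusters Gpe Gpu i)).Reachable (F X) (F Y) := by
      rintro X Y ⟨p⟩
      induction p with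
      | nil => exact SimpleGraph.Reachable.refl _
      | cons h _ ih' =>
        refine SimpleGraph.Reachable.trans ?_ ih'
        exact reachable_of_setAdj _ _ _ _ _
          (setAdj_mono (setAdj_image h.2.1) (hsub _ _) (hsub _ _))
          (setAdj_mono (setAdj_image h.2.2) (hsub _ _) (hsub _ _))
    obtain ⟨B, hB, hBs⟩ := exists_step Gpe Gpu (clusters Gpe Gpu i) (F A)
    refine ⟨B, hB, ?_⟩
    rintro _ ⟨x, ⟨X, ⟨hX, hXA⟩, hx⟩, rfl⟩
    exact hBs _ (key ⟨X, hX⟩ A (SimpleGraph.ConnectedComponent.exact hXA))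
      (hsub X hX ⟨x, hx, rfl⟩)

theorem exists_crossing {V : Type*} (G : SimpleGraph V) (hG : G.Connected) (S : Set V)
    (hS : S.Nonempty) (hne : S ≠ Set.univ) : ∃ s ∈ S, ∃ v, v ∉ S ∧ G.Adj s v := by
  by_contra hcon
  push Not at hcon
  apply hne
  obtain ⟨s, hs⟩ := hS
  refine Set.eq_univ_of_forall fun v => ?_
  obtain ⟨p⟩ := hG.preconnected s v
  induction p with
  | nil => exact hs
  | cons h _ ih =>
    refine ih ?_
    by_contra hn
    exact hcon _ hs _ hn h

theorem grow {V : Type*} [Finite V] (Gpe Gpu : SimpleGraph V) (hconn : Gpu.Connected)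
    (U : Set V) (hU : U.Nonempty) (hadj : ∀ v : V, v ∉ U → ∃ u ∈ U, Gpe.Adj v u) (n : ℕ) :
    ∀ i, ∀ B ∈ clusters Gpe Gpu i, U ⊆ B → Bᶜ.ncard ≤ n → Solves Gpe Gpu := by
  induction n with
  | zero =>
    intro i B hB _ hc
    have hBu : B = Set.univ := by
      have := (Set.ncard_eq_zero (Set.toFinite _)).1 (Nat.le_zero.1 hc)
      exact Set.compl_empty_iff.1 this
    subst hBu
    refine ⟨i, Set.eq_singleton_iff_unique_mem.2 ⟨hB, fun A hA => ?_⟩⟩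
    obtain ⟨-, h2, h3⟩ := partProp_clusters Gpe Gpu i
    obtain ⟨x, hx⟩ := h2 A hA
    exact h3 A hA _ hB x hx trivial
  | succ n ih =>
    intro i B hB hUB hc
    by_cases hne : B = Set.univ
    · exact ih i B hB hUB (by simp [hne])
    obtain ⟨s, hs, v, hv, hsv⟩ := exists_crossing Gpu hconn B (hU.mono hUB) hne
    obtain ⟨A, hA, hvA⟩ := (partProp_clusters Gpe Gpu i).1 v
    obtain ⟨u, hu, hvu⟩ := hadj v (fun h => hv (hUB h))
    obtain ⟨D, hD, hDs⟩ := exists_step Gpe Gpu (clusters Gpe Gpu i) ⟨B, hB⟩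
    have hBD : B ⊆ D := hDs ⟨B, hB⟩ (SimpleGraph.Reachable.refl _)
    have hAD : A ⊆ D := hDs ⟨A, hA⟩ (reachable_of_setAdj _ _ _ _ _
      ⟨v, hvA, u, hUB hu, hvu⟩ ⟨v, hvA, s, hs, hsv.symm⟩)
    refine ih (i + 1) D hD (hUB.trans hBD) ?_
    have hlt : Dᶜ.ncard < Bᶜ.ncard := by
      refine Set.ncard_lt_ncard ?_ (Set.toFinite _)
      exact ⟨Set.compl_subset_compl.2 hBD, fun h => h hv (hAD hvA)⟩
    omega

end Jigsaw

/-- If the puzzle graph is connected, `U` is nonempty and internally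
solved, and every vertex outside `U` has a people-edge into `U`, then the people graph
solves the puzzle. -/
theorem jigsaw_solves_of_internally_solved {V : Type*} [Fintype V]
    (Gpe Gpu : SimpleGraph V) (hconn : Gpu.Connected) (U : Set V) (hU : U.Nonempty)
    (hsolved : Jigsaw.InternallySolved Gpe Gpu U)
    (hadj : ∀ v : V, v ∉ U → ∃ u ∈ U, Gpe.Adj v u) :
    Jigsaw.Solves Gpe Gpu := by
  obtain ⟨i, hi⟩ := hsolved
  obtain ⟨B, hB, hs⟩ := Jigsaw.induced_sub Gpe Gpu U i Set.univ (by rw [hi]; rfl)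
  refine Jigsaw.grow Gpe Gpu hconn U hU hadj _ i B hB ?_ le_rfl
  intro x hx
  exact hs ⟨⟨x, hx⟩, trivial, rfl⟩
end
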